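/- For a permutation w in S_n with length ℓ(w) = ℓ, the following are equivalent: (a) w contains the pattern 321 exactly once and avoids the pattern 3412; (b) the Bruhat interval [e,w] is isomorphic as a poset to the product S_3 × B_{ℓ−3}, where S_3 carries its Bruhat order and B_{ℓ−3} is the Boolean lattice of rank ℓ−3. -/

import Mathlib

/-- `simpleT n i` is the adjacent transposition `sᵢ = (i, i+1)` (one-indexed values),
acting on `{1, …, n}` represented (zero-indexed) by `Fin n`.  It is the identity
permutation when `i` is outside the valid range `1 ≤ i ≤ n - 1`. -/
def simpleT (n : ℕ) (i : ℕ) : Equiv.Perm (Fin n) :=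
  if h : 1 ≤ i ∧ i < n then Equiv.swap ⟨i - 1, by omega⟩ ⟨i, h.2⟩ else 1

/-- The (Coxeter) length `ℓ(w)`: the minimal number of adjacent transpositions whose
product is `w`. -/
noncomputable def permLen (n : ℕ) (w : Equiv.Perm (Fin n)) : ℕ :=
  sInf {l : ℕ | ∃ word : List ℕ, word.length = l ∧ (word.map (simpleT n)).prod = w}

/-- `word` is a reduced decomposition of `w`: its product is `w` and its length is `ℓ(w)`. -/
def IsReducedWord (n : ℕ) (word : List ℕ) (w : Equiv.Perm (Fin n)) : Prop :=
  (word.map (simpleT n)).prod = w ∧ word.length = permLen n w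

/-- The support of `w`: the set of letters `i` such that `sᵢ` appears in some reduced
decomposition of `w`. -/
def permSupp (n : ℕ) (w : Equiv.Perm (Fin n)) : Set ℕ :=
  {i | ∃ word : List ℕ, IsReducedWord n word w ∧ i ∈ word}

/-- Bruhat order: `v ≤ w` iff some reduced decomposition of `v` is a subword of some
reduced decomposition of `w`. -/
def bruhatLE (n : ℕ) (v w : Equiv.Perm (Fin n)) : Prop :=
  ∃ wordv wordw : List ℕ, IsReducedWord n wordv v ∧ IsReducedWord n wordw w ∧
    wordv.Sublist wordw

/-- Strict Bruhat order. -/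
def bruhatLT (n : ℕ) (v w : Equiv.Perm (Fin n)) : Prop :=
  bruhatLE n v w ∧ v ≠ w

/-- An occurrence of the pattern `p ∈ S_k` in `w ∈ S_n`: a strictly increasing sequence
`j` of indices such that the entries of `w` along `j` are in the same relative order
as the entries of `p`. -/
def IsPatternOcc {n k : ℕ} (w : Equiv.Perm (Fin n)) (p : Equiv.Perm (Fin k))
    (j : Fin k → Fin n) : Prop :=
  StrictMono j ∧ ∀ a b : Fin k, w (j a) < w (j b) ↔ p a < p b

/-- `w` contains the pattern `p`. -/
def ContainsPattern {n k : ℕ} (w : Equiv.Perm (Fin n)) (p : Equiv.Perm (Fin k)) : Prop :=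
  ∃ j : Fin k → Fin n, IsPatternOcc w p j

/-- `w` avoids the pattern `p`. -/
def AvoidsPattern {n k : ℕ} (w : Equiv.Perm (Fin n)) (p : Equiv.Perm (Fin k)) : Prop :=
  ¬ ContainsPattern w p

/-- `w` contains the pattern `p` exactly once. -/
def ContainsPatternOnce {n k : ℕ} (w : Equiv.Perm (Fin n)) (p : Equiv.Perm (Fin k)) : Prop :=
  ∃! j : Fin k → Fin n, IsPatternOcc w p j

/-- The number of occurrences of the pattern `p` in `w`. -/
noncomputable def numOcc {n k : ℕ} (w : Equiv.Perm (Fin n)) (p : Equiv.Perm (Fin k)) : ℕ :=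
  Set.ncard {j : Fin k → Fin n | IsPatternOcc w p j}

/-- The pattern `321` (one-line notation `1↦3, 2↦2, 3↦1`), as a permutation of `Fin 3`. -/
def pattern321 : Equiv.Perm (Fin 3) := Equiv.swap 0 2

/-- The pattern `3412` (one-line notation `1↦3, 2↦4, 3↦1, 4↦2`). -/
def pattern3412 : Equiv.Perm (Fin 4) := Equiv.swap 0 2 * Equiv.swap 1 3

/-- The pattern `4231` (one-line notation `1↦4, 2↦2, 3↦3, 4↦1`). -/
def pattern4231 : Equiv.Perm (Fin 4) := Equiv.swap 0 3

/-- The pattern `4321` (one-line notation `1↦4, 2↦3, 3↦2, 4↦1`). -/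
def pattern4321 : Equiv.Perm (Fin 4) := Equiv.swap 0 3 * Equiv.swap 1 2

/-- The point `(u(1), …, u(n)) ∈ ℝⁿ` attached to a permutation `u` (one-indexed values). -/
def permPoint (n : ℕ) (u : Equiv.Perm (Fin n)) : Fin n → ℝ :=
  fun k => ((u k : ℕ) : ℝ) + 1

/-- The Bruhat interval polytope `Q_{v,w}`: the convex hull of the points
`(u(1), …, u(n))` for all `u` with `v ≤ u ≤ w` in Bruhat order. -/
noncomputable def BIP (n : ℕ) (v w : Equiv.Perm (Fin n)) : Set (Fin n → ℝ) :=
  convexHull ℝ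
    {x | ∃ u : Equiv.Perm (Fin n), bruhatLE n v u ∧ bruhatLE n u w ∧ x = permPoint n u}

/-- A face of a polytope `P`: a convex extreme subset of `P`. -/
def IsFaceOf {E : Type*} [AddCommGroup E] [Module ℝ E] (P F : Set E) : Prop :=
  IsExtreme ℝ P F ∧ Convex ℝ F

/-- Combinatorial equivalence of two polytopes: an inclusion-preserving (in both
directions) bijection between their face lattices. -/
def CombEquiv {E F : Type*} [AddCommGroup E] [Module ℝ E] [AddCommGroup F] [Module ℝ F]
    (P : Set E) (Q : Set F) : Prop :=
  ∃ e : {A : Set E // IsFaceOf P A} ≃ {B : Set F // IsFaceOf Q B},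
    ∀ A B : {A : Set E // IsFaceOf P A}, A.1 ⊆ B.1 ↔ (e A).1 ⊆ (e B).1

/-- The transposition `(i, j)` (one-indexed values, `1 ≤ i < j ≤ n`), acting on
`{1, …, n}` represented by `Fin n`; identity for invalid input. -/
def transpPerm (n i j : ℕ) : Equiv.Perm (Fin n) :=
  if h : 1 ≤ i ∧ i < j ∧ j ≤ n then Equiv.swap ⟨i - 1, by omega⟩ ⟨j - 1, by omega⟩ else 1

/-- `T̄(u,[v,w])`: the set of transpositions `(i,j)`, `i < j`, with
`u < u·(i,j) ≤ w` and `ℓ(u·(i,j)) = ℓ(u) + 1`. -/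
def upperT (n : ℕ) (u v w : Equiv.Perm (Fin n)) : Set (ℕ × ℕ) :=
  {p | 1 ≤ p.1 ∧ p.1 < p.2 ∧ p.2 ≤ n ∧
    bruhatLT n u (u * transpPerm n p.1 p.2) ∧ bruhatLE n (u * transpPerm n p.1 p.2) w ∧
    permLen n (u * transpPerm n p.1 p.2) = permLen n u + 1}

/-- `T̲(u,[v,w])`: the set of transpositions `(i,j)`, `i < j`, with
`v ≤ u·(i,j) < u` and `ℓ(u·(i,j)) = ℓ(u) - 1`. -/
def lowerT (n : ℕ) (u v w : Equiv.Perm (Fin n)) : Set (ℕ × ℕ) :=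
  {p | 1 ≤ p.1 ∧ p.1 < p.2 ∧ p.2 ≤ n ∧
    bruhatLE n v (u * transpPerm n p.1 p.2) ∧ bruhatLT n (u * transpPerm n p.1 p.2) u ∧
    permLen n (u * transpPerm n p.1 p.2) + 1 = permLen n u}

/-- The permutohedron `Perm₂ ⊂ ℝ³`, a hexagon. -/
noncomputable def Perm2Hex : Set (Fin 3 → ℝ) :=
  convexHull ℝ {x | ∃ σ : Equiv.Perm (Fin 3), x = permPoint 3 σ}

/-- The action of `s_r` on one-indexed letters: swaps `r` and `r + 1`. -/
def srNat (r x : ℕ) : ℕ := if x = r then r + 1 else if x = r + 1 then r else x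


namespace Sub9

abbrev pr (n : ℕ) (L : List ℕ) : Equiv.Perm (Fin n) := (L.map (simpleT n)).prod

lemma pr_nil (n : ℕ) : pr n [] = 1 := rfl
lemma pr_cons (n k : ℕ) (L : List ℕ) : pr n (k :: L) = simpleT n k * pr n L := by simp [pr]
lemma pr_append (n : ℕ) (L M : List ℕ) : pr n (L ++ M) = pr n L * pr n M := by simp [pr]

lemma sT_val {n k : ℕ} (h1 : 1 ≤ k) (h2 : k < n) (x : Fin n) :
    (simpleT n k x).val = if x.val = k - 1 then k else if x.val = k then k - 1 else x.val := by
  unfold simpleT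
  rw [dif_pos ⟨h1, h2⟩, Equiv.swap_apply_def]
  simp only [Fin.ext_iff]
  split_ifs <;> rfl

lemma sT_inv {n k : ℕ} (h : ¬ (1 ≤ k ∧ k < n)) : simpleT n k = 1 := by
  unfold simpleT
  rw [dif_neg h]

lemma sT_sq (n k : ℕ) : simpleT n k * simpleT n k = 1 := by
  unfold simpleT
  split_ifs <;> simp

lemma sT_lt {n k p : ℕ} (h : k ≠ p) (x : Fin n) : (simpleT n k x).val < p ↔ x.val < p := by
  by_cases hk : 1 ≤ k ∧ k < n
  · rw [sT_val hk.1 hk.2]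
    split_ifs <;> omega
  · simp [sT_inv hk]

lemma pr_lt {n p : ℕ} {L : List ℕ} (h : p ∉ L) (x : Fin n) : (pr n L x).val < p ↔ x.val < p := by
  induction L with
  | nil => simp [pr]
  | cons k L ih =>
    simp only [List.mem_cons, not_or] at h
    rw [pr_cons, Equiv.Perm.mul_apply, sT_lt (fun e => h.1 e.symm), ih h.2]

lemma pl_le {n : ℕ} (L : List ℕ) : permLen n (pr n L) ≤ L.length :=
  Nat.sInf_le ⟨L, rfl, rfl⟩

lemma exists_red {n : ℕ} (L : List ℕ) : ∃ M, IsReducedWord n M (pr n L) := by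
  obtain ⟨M, h1, h2⟩ := Nat.sInf_mem (s := {l : ℕ | ∃ word : List ℕ, word.length = l ∧
    (word.map (simpleT n)).prod = pr n L}) ⟨_, L, rfl, rfl⟩
  exact ⟨M, h2, h1⟩

/-- reduced words -/
def Rd (n : ℕ) (L : List ℕ) : Prop := ∀ M, pr n M = pr n L → L.length ≤ M.length

lemma rd_iff {n : ℕ} (L : List ℕ) (w) : IsReducedWord n L w ↔ Rd n L ∧ pr n L = w := by
  constructor
  · rintro ⟨h1, h2⟩
    refine ⟨fun M hM => ?_, h1⟩
    rw [h2, ← h1]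
    have := pl_le (n := n) M
    rw [hM] at this
    exact this
  · rintro ⟨h1, rfl⟩
    refine ⟨rfl, le_antisymm ?_ (pl_le L)⟩
    obtain ⟨M, hM1, hM2⟩ := exists_red (n := n) L
    rw [← hM2]
    exact h1 M hM1

lemma exists_rd {n : ℕ} (L : List ℕ) : ∃ M, Rd n M ∧ pr n M = pr n L := by
  obtain ⟨M, h⟩ := exists_red (n := n) L
  exact ⟨M, (rd_iff _ _).1 h⟩

lemma rd_len {n : ℕ} {L : List ℕ} (h : Rd n L) : permLen n (pr n L) = L.length :=
  (((rd_iff L _).2 ⟨h, rfl⟩).2).symm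

lemma rd_tail {n k : ℕ} {L : List ℕ} (h : Rd n (k :: L)) : Rd n L := by
  intro M hM
  have := h (k :: M) (by rw [pr_cons, pr_cons, hM])
  simpa using this

lemma rd_valid {n k : ℕ} {L : List ℕ} (h : Rd n (k :: L)) : 1 ≤ k ∧ k < n := by
  by_contra hk
  have := h L (by rw [pr_cons, sT_inv hk, one_mul])
  simp at this

lemma rd_valid' {n : ℕ} {L : List ℕ} (h : Rd n L) : ∀ k ∈ L, 1 ≤ k ∧ k < n := by
  induction L with
  | nil => simp
  | cons a L ih =>
    intro k hk
    rcases List.mem_cons.1 hk with rfl | hk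
    · exact rd_valid h
    · exact ih (rd_tail h) k hk

lemma swap_step {n k : ℕ} (h1 : 1 ≤ k) (h2 : k < n) (g : Equiv.Perm (Fin n)) (x y : Fin n)
    (hx : (g x).val = k - 1) (hy : (g y).val = k) : simpleT n k * g = g * Equiv.swap x y := by
  have : simpleT n k = Equiv.swap (g x) (g y) := by
    unfold simpleT
    rw [dif_pos ⟨h1, h2⟩]
    congr 1 <;> ext <;> simp [hx, hy]
  rw [this, Equiv.mul_swap_eq_swap_mul]

lemma exch {n : ℕ} (L : List ℕ) (x y : Fin n) (hxy : x < y) (h : pr n L y < pr n L x) :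
    ∃ M, M.length + 1 = L.length ∧ pr n M = pr n L * Equiv.swap x y := by
  induction L with
  | nil => simp [pr] at h; omega
  | cons k L ih =>
    by_cases h' : pr n L y < pr n L x
    · obtain ⟨M, hM, e⟩ := ih h'
      exact ⟨k :: M, by simp [hM], by rw [pr_cons, pr_cons, e, mul_assoc]⟩
    · have hne : pr n L y ≠ pr n L x := fun e => by
        have := (pr n L).injective e
        omega
      rw [pr_cons, Equiv.Perm.mul_apply, Equiv.Perm.mul_apply] at h
      by_cases hk : 1 ≤ k ∧ k < n
      · rw [Fin.lt_def, sT_val hk.1 hk.2, sT_val hk.1 hk.2] at h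
        rw [Fin.lt_def] at h'
        rw [Ne, Fin.ext_iff] at hne
        have : (pr n L x).val = k - 1 ∧ (pr n L y).val = k := by
          split_ifs at h <;> omega
        refine ⟨L, by simp, ?_⟩
        rw [pr_cons, mul_assoc, ← swap_step hk.1 hk.2 _ x y this.1 this.2, ← mul_assoc, sT_sq,
          one_mul]
      · rw [sT_inv hk] at h
        exact absurd h h'

lemma rd_asc {n k : ℕ} {L : List ℕ} (h : Rd n (k :: L)) (x y : Fin n)
    (hx : (pr n L x).val = k - 1) (hy : (pr n L y).val = k) : x < y := by
  have hk := rd_valid h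
  by_contra hlt
  have hne : x ≠ y := by rintro rfl; omega
  have hlt : y < x := lt_of_le_of_ne (not_lt.1 hlt) hne.symm
  obtain ⟨M, hM, e⟩ := exch L y x hlt (by rw [Fin.lt_def]; omega)
  have := h M (by rw [pr_cons, e, swap_step hk.1 hk.2 _ x y hx hy, Equiv.swap_comm])
  simp at this
  omega

def PP {n : ℕ} (p q : ℕ) (w : Equiv.Perm (Fin n)) : Prop := ∃ a : Fin n, a.val < p ∧ q ≤ (w a).val
def QQ {n : ℕ} (p q : ℕ) (w : Equiv.Perm (Fin n)) : Prop := ∃ a : Fin n, p ≤ a.val ∧ (w a).val < q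

instance {n p q : ℕ} (w : Equiv.Perm (Fin n)) : Decidable (PP p q w) := by unfold PP; infer_instance
instance {n p q : ℕ} (w : Equiv.Perm (Fin n)) : Decidable (QQ p q w) := by unfold QQ; infer_instance

lemma exists_val {n : ℕ} (g : Equiv.Perm (Fin n)) {k : ℕ} (h : k < n) : ∃ x, (g x).val = k :=
  ⟨g.symm ⟨k, h⟩, by simp⟩

lemma PP_step {n p q k : ℕ} {L : List ℕ} (h : Rd n (k :: L)) (hP : PP p q (pr n L)) :
    PP p q (pr n (k :: L)) := by
  have hk := rd_valid h
  obtain ⟨x, hx⟩ := exists_val (pr n L) (show k - 1 < n by omega)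
  obtain ⟨y, hy⟩ := exists_val (pr n L) hk.2
  have hxy := rd_asc h x y hx hy
  obtain ⟨a, ha, hq⟩ := hP
  by_cases hay : (pr n L a).val = k
  · have : a = y := (pr n L).injective (Fin.ext (hay.trans hy.symm))
    refine ⟨x, by omega, ?_⟩
    rw [pr_cons, Equiv.Perm.mul_apply, sT_val hk.1 hk.2, if_pos hx]
    omega
  · refine ⟨a, ha, ?_⟩
    rw [pr_cons, Equiv.Perm.mul_apply, sT_val hk.1 hk.2]
    split_ifs <;> omega

lemma QQ_step {n p q k : ℕ} {L : List ℕ} (h : Rd n (k :: L)) (hP : QQ p q (pr n L)) :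
    QQ p q (pr n (k :: L)) := by
  have hk := rd_valid h
  obtain ⟨x, hx⟩ := exists_val (pr n L) (show k - 1 < n by omega)
  obtain ⟨y, hy⟩ := exists_val (pr n L) hk.2
  have hxy := rd_asc h x y hx hy
  obtain ⟨a, ha, hq⟩ := hP
  by_cases hay : (pr n L a).val = k - 1
  · have : a = x := (pr n L).injective (Fin.ext (hay.trans hx.symm))
    refine ⟨y, by omega, ?_⟩
    rw [pr_cons, Equiv.Perm.mul_apply, sT_val hk.1 hk.2, if_neg (by omega), if_pos hy]
    omega
  · refine ⟨a, ha, ?_⟩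
    rw [pr_cons, Equiv.Perm.mul_apply, sT_val hk.1 hk.2]
    split_ifs <;> omega

lemma PP_mono {n p : ℕ} {M L : List ℕ} (h : M.Sublist L) : ∀ q, Rd n L → PP p q (pr n M) →
    PP p q (pr n L) := by
  induction h with
  | slnil => intro q _ h; exact h
  | cons k hs ih => intro q hr hP; exact PP_step hr (ih q (rd_tail hr) hP)
  | @cons_cons M L k hs ih =>
    intro q hr hP
    have hk := rd_valid hr
    by_cases hkq : k = q
    · obtain ⟨a, ha, hq⟩ := hP
      have : PP p (q - 1) (pr n M) := by
        refine ⟨a, ha, ?_⟩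
        rw [pr_cons, Equiv.Perm.mul_apply, sT_val hk.1 hk.2] at hq
        split_ifs at hq <;> omega
      obtain ⟨a, ha, hq⟩ := ih _ (rd_tail hr) this
      obtain ⟨x, hx⟩ := exists_val (pr n L) (show k - 1 < n by omega)
      obtain ⟨y, hy⟩ := exists_val (pr n L) hk.2
      have hxy := rd_asc hr x y hx hy
      by_cases hay : (pr n L a).val = k
      · have : a = y := (pr n L).injective (Fin.ext (hay.trans hy.symm))
        refine ⟨x, by omega, ?_⟩
        rw [pr_cons, Equiv.Perm.mul_apply, sT_val hk.1 hk.2, if_pos hx]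
        omega
      · refine ⟨a, ha, ?_⟩
        rw [pr_cons, Equiv.Perm.mul_apply, sT_val hk.1 hk.2]
        split_ifs <;> omega
    · obtain ⟨a, ha, hq⟩ := hP
      apply PP_step hr
      apply ih _ (rd_tail hr)
      refine ⟨a, ha, ?_⟩
      rw [pr_cons, Equiv.Perm.mul_apply] at hq
      have := sT_lt hkq (pr n M a)
      omega

lemma QQ_mono {n p : ℕ} {M L : List ℕ} (h : M.Sublist L) : ∀ q, Rd n L → QQ p q (pr n M) →
    QQ p q (pr n L) := by
  induction h with
  | slnil => intro q _ h; exact h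
  | cons k hs ih => intro q hr hP; exact QQ_step hr (ih q (rd_tail hr) hP)
  | @cons_cons M L k hs ih =>
    intro q hr hP
    have hk := rd_valid hr
    by_cases hkq : k = q
    · obtain ⟨a, ha, hq⟩ := hP
      have : QQ p (q + 1) (pr n M) := by
        refine ⟨a, ha, ?_⟩
        rw [pr_cons, Equiv.Perm.mul_apply, sT_val hk.1 hk.2] at hq
        split_ifs at hq <;> omega
      obtain ⟨a, ha, hq⟩ := ih _ (rd_tail hr) this
      obtain ⟨x, hx⟩ := exists_val (pr n L) (show k - 1 < n by omega)
      obtain ⟨y, hy⟩ := exists_val (pr n L) hk.2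
      have hxy := rd_asc hr x y hx hy
      by_cases hay : (pr n L a).val = k - 1
      · have : a = x := (pr n L).injective (Fin.ext (hay.trans hx.symm))
        refine ⟨y, by omega, ?_⟩
        rw [pr_cons, Equiv.Perm.mul_apply, sT_val hk.1 hk.2, if_neg (by omega), if_pos hy]
        omega
      · refine ⟨a, ha, ?_⟩
        rw [pr_cons, Equiv.Perm.mul_apply, sT_val hk.1 hk.2]
        split_ifs <;> omega
    · obtain ⟨a, ha, hq⟩ := hP
      apply QQ_step hr
      apply ih _ (rd_tail hr)
      refine ⟨a, ha, ?_⟩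
      rw [pr_cons, Equiv.Perm.mul_apply] at hq
      have := sT_lt hkq (pr n M a)
      omega

lemma PP_le {n p q : ℕ} {v w : Equiv.Perm (Fin n)} (h : bruhatLE n v w) (hP : PP p q v) :
    PP p q w := by
  obtain ⟨M, L, h1, h2, h3⟩ := h
  rw [rd_iff] at h1 h2
  rw [← h2.2]; rw [← h1.2] at hP
  exact PP_mono h3 _ h2.1 hP

lemma QQ_le {n p q : ℕ} {v w : Equiv.Perm (Fin n)} (h : bruhatLE n v w) (hP : QQ p q v) :
    QQ p q w := by
  obtain ⟨M, L, h1, h2, h3⟩ := h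
  rw [rd_iff] at h1 h2
  rw [← h2.2]; rw [← h1.2] at hP
  exact QQ_mono h3 _ h2.1 hP

/-- no `k` in word -> not PP k k -/
lemma not_PP {n k : ℕ} {L : List ℕ} (h : k ∉ L) : ¬ PP k k (pr n L) := by
  rintro ⟨a, h1, h2⟩
  have := (pr_lt h a).2 h1
  omega

lemma PP_single {n k : ℕ} (h1 : 1 ≤ k) (h2 : k < n) : PP k k (pr n [k]) := by
  refine ⟨⟨k - 1, by omega⟩, by simp; omega, ?_⟩
  rw [pr_cons, Equiv.Perm.mul_apply, pr_nil, sT_val h1 h2]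
  simp

lemma rd_single {n k : ℕ} (h1 : 1 ≤ k) (h2 : k < n) : Rd n [k] := by
  intro M hM
  rcases M with _ | ⟨a, M⟩
  · have := PP_single h1 h2
    rw [← hM] at this
    exact absurd this (not_PP (by simp))
  · simp

/-- support criterion -/
lemma mem_iff_PP {n k : ℕ} {L : List ℕ} (h : Rd n L) : k ∈ L ↔ PP k k (pr n L) := by
  constructor
  · intro hk
    have hv := rd_valid' h k hk
    exact PP_mono (List.singleton_sublist.2 hk) _ h (PP_single hv.1 hv.2)
  · intro hP
    by_contra hk
    exact not_PP hk hP

end Sub9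


namespace Sub9

lemma rd_of_len {n : ℕ} {L M : List ℕ} (h : Rd n L) (e : pr n M = pr n L)
    (hl : M.length ≤ L.length) : Rd n M := fun K hK => hl.trans (h K (hK.trans e))

lemma rd_desc {n k : ℕ} {L : List ℕ} (h : Rd n (k :: L)) :
    ∃ x y : Fin n, x < y ∧ (pr n (k :: L) x).val = k ∧ (pr n (k :: L) y).val = k - 1 := by
  have hk := rd_valid h
  obtain ⟨x, hx⟩ := exists_val (pr n L) (show k - 1 < n by omega)
  obtain ⟨y, hy⟩ := exists_val (pr n L) hk.2
  refine ⟨x, y, rd_asc h x y hx hy, ?_, ?_⟩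
  · rw [pr_cons, Equiv.Perm.mul_apply, sT_val hk.1 hk.2, if_pos hx]
  · rw [pr_cons, Equiv.Perm.mul_apply, sT_val hk.1 hk.2, if_neg (by omega), if_pos hy]

lemma desc_word {n k : ℕ} {L : List ℕ} (h : Rd n L) (h1 : 1 ≤ k) (h2 : k < n) (x y : Fin n)
    (hxy : x < y) (hx : (pr n L x).val = k) (hy : (pr n L y).val = k - 1) :
    ∃ K, Rd n (k :: K) ∧ pr n (k :: K) = pr n L := by
  obtain ⟨M, hM, e⟩ := exch L x y hxy (by rw [Fin.lt_def]; omega)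
  have e2 : pr n (k :: M) = pr n L := by
    rw [pr_cons, e, Equiv.swap_comm, ← swap_step h1 h2 _ y x hy hx, ← mul_assoc, sT_sq, one_mul]
  exact ⟨M, rd_of_len h e2 (by simp [hM]), e2⟩

lemma sT_comm {n s t : ℕ} (h : s + 1 < t ∨ t + 1 < s) :
    simpleT n s * simpleT n t = simpleT n t * simpleT n s := by
  by_cases hs : 1 ≤ s ∧ s < n
  · by_cases ht : 1 ≤ t ∧ t < n
    · ext x
      simp only [Equiv.Perm.mul_apply, sT_val hs.1 hs.2, sT_val ht.1 ht.2]
      split_ifs <;> omega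
    · simp [sT_inv ht]
  · simp [sT_inv hs]

lemma sT_braid {n s : ℕ} (h1 : 1 ≤ s) (h2 : s + 1 < n) :
    simpleT n s * simpleT n (s + 1) * simpleT n s =
      simpleT n (s + 1) * simpleT n s * simpleT n (s + 1) := by
  have a := fun x => sT_val h1 (show s < n by omega) x
  have b := fun x => sT_val (show 1 ≤ s + 1 by omega) h2 x
  ext x
  simp only [Equiv.Perm.mul_apply]
  rcases (by omega : x.val = s - 1 ∨ x.val = s ∨ x.val = s + 1 ∨
    (x.val ≠ s - 1 ∧ x.val ≠ s ∧ x.val ≠ s + 1)) with h | h | h | h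
  all_goals
    simp only [a, b]
    simp [h, show s ≠ s - 1 by omega, show s - 1 ≠ s by omega, show s - 1 ≠ s + 1 by omega,
      show s + 1 ≠ s - 1 by omega]

def DD (n : ℕ) (L : List ℕ) (v : Equiv.Perm (Fin n)) : Prop := ∃ M, M.Sublist L ∧ pr n M = v

lemma DD_append {n : ℕ} (L K : List ℕ) (v : Equiv.Perm (Fin n)) :
    DD n (L ++ K) v ↔ ∃ a b, DD n L a ∧ DD n K b ∧ v = a * b := by
  constructor
  · rintro ⟨M, hM, rfl⟩
    obtain ⟨M1, M2, rfl, h1, h2⟩ := List.sublist_append_iff.1 hM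
    exact ⟨_, _, ⟨M1, h1, rfl⟩, ⟨M2, h2, rfl⟩, pr_append _ _ _⟩
  · rintro ⟨_, _, ⟨M1, h1, rfl⟩, ⟨M2, h2, rfl⟩, rfl⟩
    exact ⟨M1 ++ M2, h1.append h2, pr_append _ _ _⟩

lemma DD_cons {n k : ℕ} (K : List ℕ) (v : Equiv.Perm (Fin n)) :
    DD n (k :: K) v ↔ DD n K v ∨ DD n K (simpleT n k * v) := by
  constructor
  · rintro ⟨M, hM, rfl⟩
    rcases List.sublist_cons_iff.1 hM with h | ⟨r, rfl, h⟩
    · exact Or.inl ⟨M, h, rfl⟩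
    · exact Or.inr ⟨r, h, by rw [pr_cons, ← mul_assoc, sT_sq, one_mul]⟩
  · rintro (⟨M, hM, h⟩ | ⟨M, hM, h⟩)
    · exact ⟨M, hM.cons _, h⟩
    · exact ⟨k :: M, hM.cons_cons _, by rw [pr_cons, h, ← mul_assoc, sT_sq, one_mul]⟩

lemma DD_comm {n s t : ℕ} (K : List ℕ) (v : Equiv.Perm (Fin n)) (h : s + 1 < t ∨ t + 1 < s)
    (hD : DD n (s :: t :: K) v) : DD n (t :: s :: K) v := by
  have e := sT_comm (n := n) h
  simp only [DD_cons, ← mul_assoc] at hD ⊢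
  rw [e] at *
  tauto

lemma DD_braid {n s t : ℕ} (K : List ℕ) (v : Equiv.Perm (Fin n))
    (e : simpleT n s * simpleT n t * simpleT n s = simpleT n t * simpleT n s * simpleT n t)
    (hD : DD n (s :: t :: s :: K) v) : DD n (t :: s :: t :: K) v := by
  simp only [DD_cons, ← mul_assoc] at hD ⊢
  simp only [e, sT_sq, one_mul] at *
  tauto

lemma DD_word {n : ℕ} : ∀ (N : ℕ) (L1 L2 : List ℕ), L1.length = N → Rd n L1 → Rd n L2 →
    pr n L1 = pr n L2 → ∀ v, DD n L1 v → DD n L2 v := by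
  intro N
  induction N using Nat.strong_induction_on with
  | _ N ih =>
  intro L1 L2 hN h1 h2 e v hD
  have hlen : L1.length = L2.length := le_antisymm (h1 _ e.symm) (h2 _ e)
  rcases L1 with _ | ⟨s, L1⟩
  · rcases L2 with _ | ⟨t, L2⟩
    · exact hD
    · simp at hlen
  rcases L2 with _ | ⟨t, L2⟩
  · simp at hlen
  have hs := rd_valid h1
  have ht := rd_valid h2
  simp only [List.length_cons] at hN hlen
  have key : ∀ K1 K2, Rd n (s :: K1) → pr n (s :: K1) = pr n (s :: L1) → Rd n (t :: K2) →
      pr n (t :: K2) = pr n (t :: L2) → (DD n (s :: K1) v → DD n (t :: K2) v) →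
      DD n (t :: L2) v := by
    intro K1 K2 hK1 e1 hK2 e2 himp
    have l1 : K1.length = L1.length := by
      have := hK1 _ e1.symm; have := h1 _ e1; simp at *; omega
    have l2 : K2.length = L2.length := by
      have := hK2 _ e2.symm; have := h2 _ e2; simp at *; omega
    have e1' : pr n K1 = pr n L1 := by simpa [pr_cons] using e1
    have e2' : pr n K2 = pr n L2 := by simpa [pr_cons] using e2
    have i1 := ih L1.length (by omega) L1 K1 rfl (rd_tail h1) (rd_tail hK1) e1'.symm
    have i2 := ih K2.length (by omega) K2 L2 rfl (rd_tail hK2) (rd_tail h2) e2'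
    rw [DD_cons] at hD
    have := himp ((DD_cons _ _).2 (hD.imp (i1 _) (i1 _)))
    rw [DD_cons] at this ⊢
    exact this.imp (i2 _) (i2 _)
  obtain ⟨x, y, hxy, hx, hy⟩ := rd_desc h1
  obtain ⟨x', y', hxy', hx', hy'⟩ := rd_desc h2
  rw [← e] at hx' hy'
  have hL : pr n L1 = simpleT n s * pr n (s :: L1) := by
    rw [pr_cons, ← mul_assoc, sT_sq, one_mul]
  rcases lt_trichotomy s t with hst | hst | hst
  · by_cases hst' : s + 1 = t
    · -- braid
      subst hst'
      -- w x = s, w y = s-1, w x' = s+1, w y' = s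
      have hxy2 : y' = x := (pr n (s :: L1)).injective (Fin.ext (by omega))
      subst hxy2
      obtain ⟨K, hK, eK⟩ := desc_word (rd_tail h1) ht.1 ht.2 x' y (by omega)
        (by rw [hL, Equiv.Perm.mul_apply, sT_val hs.1 hs.2]; split_ifs <;> omega)
        (by rw [hL, Equiv.Perm.mul_apply, sT_val hs.1 hs.2]; split_ifs <;> omega)
      have hK' : pr n K = simpleT n (s + 1) * pr n L1 := by
        rw [← eK, pr_cons, ← mul_assoc, sT_sq, one_mul]
      obtain ⟨J, hJ, eJ⟩ := desc_word (rd_tail hK) hs.1 hs.2 x' y' (by omega)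
        (by rw [hK', hL, Equiv.Perm.mul_apply, Equiv.Perm.mul_apply, sT_val ht.1 ht.2,
              sT_val hs.1 hs.2]; split_ifs <;> omega)
        (by rw [hK', hL, Equiv.Perm.mul_apply, Equiv.Perm.mul_apply, sT_val ht.1 ht.2,
              sT_val hs.1 hs.2]; split_ifs <;> omega)
      have e1 : pr n (s :: (s + 1) :: s :: J) = pr n (s :: L1) := by
        rw [pr_cons, pr_cons, eJ, ← pr_cons, eK, ← pr_cons]
      have lJ : (s :: (s + 1) :: s :: J).length = (s :: L1).length := by
        have a1 := (rd_tail h1) _ eK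
        have a2 := hK _ eK.symm
        have a3 := (rd_tail hK) _ eJ
        have a4 := hJ _ eJ.symm
        simp at *; omega
      have br := sT_braid (n := n) hs.1 ht.2
      have e2 : pr n ((s + 1) :: s :: (s + 1) :: J) = pr n (s :: L1) := by
        rw [← e1]; simp only [pr_cons, ← mul_assoc, br]
      refine key _ _ (rd_of_len h1 e1 lJ.le) e1 (rd_of_len h1 e2 ?_) (e2.trans e) (DD_braid J v br)
      rw [← lJ]; simp
    · obtain ⟨K, hK, eK⟩ := desc_word (rd_tail h1) ht.1 ht.2 x' y' (by omega)
        (by rw [hL, Equiv.Perm.mul_apply, sT_val hs.1 hs.2]; split_ifs <;> omega)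
        (by rw [hL, Equiv.Perm.mul_apply, sT_val hs.1 hs.2]; split_ifs <;> omega)
      have e1 : pr n (s :: t :: K) = pr n (s :: L1) := by rw [pr_cons, eK, ← pr_cons]
      have e2 : pr n (t :: s :: K) = pr n (s :: L1) := by
        rw [← e1]; simp only [pr_cons, ← mul_assoc]
        rw [sT_comm (by omega)]
      have a2 := hK _ eK.symm
      exact key _ _ (rd_of_len h1 e1 (by simp at *; omega)) e1
        (rd_of_len h1 e2 (by simp at *; omega)) (e2.trans e) (DD_comm K v (by omega))
  · subst hst
    exact key L1 L2 h1 rfl h2 rfl (by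
      have e' : pr n L1 = pr n L2 := by simpa [pr_cons] using e
      rw [DD_cons, DD_cons]
      have := ih L1.length (by omega) L1 L2 rfl (rd_tail h1) (rd_tail h2) e'
      exact Or.imp (this _) (this _))
  · by_cases hst' : t + 1 = s
    · subst hst'
      -- w x = t+1, w y = t, w x' = t, w y' = t-1
      have hxy2 : y = x' := (pr n ((t + 1) :: L1)).injective (Fin.ext (by omega))
      subst hxy2
      obtain ⟨K, hK, eK⟩ := desc_word (rd_tail h1) ht.1 ht.2 x y' (by omega)
        (by rw [hL, Equiv.Perm.mul_apply, sT_val hs.1 hs.2]; split_ifs <;> omega)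
        (by rw [hL, Equiv.Perm.mul_apply, sT_val hs.1 hs.2]; split_ifs <;> omega)
      have hK' : pr n K = simpleT n t * pr n L1 := by
        rw [← eK, pr_cons, ← mul_assoc, sT_sq, one_mul]
      obtain ⟨J, hJ, eJ⟩ := desc_word (rd_tail hK) hs.1 hs.2 y y' (by omega)
        (by rw [hK', hL, Equiv.Perm.mul_apply, Equiv.Perm.mul_apply, sT_val ht.1 ht.2,
              sT_val hs.1 hs.2]; split_ifs <;> omega)
        (by rw [hK', hL, Equiv.Perm.mul_apply, Equiv.Perm.mul_apply, sT_val ht.1 ht.2,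
              sT_val hs.1 hs.2]; split_ifs <;> omega)
      have e1 : pr n ((t + 1) :: t :: (t + 1) :: J) = pr n ((t + 1) :: L1) := by
        rw [pr_cons, pr_cons, eJ, ← pr_cons, eK, ← pr_cons]
      have lJ : ((t + 1) :: t :: (t + 1) :: J).length = ((t + 1) :: L1).length := by
        have a1 := (rd_tail h1) _ eK
        have a2 := hK _ eK.symm
        have a3 := (rd_tail hK) _ eJ
        have a4 := hJ _ eJ.symm
        simp at *; omega
      have br := (sT_braid (n := n) ht.1 hs.2).symm
      have e2 : pr n (t :: (t + 1) :: t :: J) = pr n ((t + 1) :: L1) := by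
        rw [← e1]; simp only [pr_cons, ← mul_assoc, br]
      refine key _ _ (rd_of_len h1 e1 lJ.le) e1 (rd_of_len h1 e2 ?_) (e2.trans e) (DD_braid J v br)
      rw [← lJ]; simp
    · obtain ⟨K, hK, eK⟩ := desc_word (rd_tail h1) ht.1 ht.2 x' y' (by omega)
        (by rw [hL, Equiv.Perm.mul_apply, sT_val hs.1 hs.2]; split_ifs <;> omega)
        (by rw [hL, Equiv.Perm.mul_apply, sT_val hs.1 hs.2]; split_ifs <;> omega)
      have e1 : pr n (s :: t :: K) = pr n (s :: L1) := by rw [pr_cons, eK, ← pr_cons]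
      have e2 : pr n (t :: s :: K) = pr n (s :: L1) := by
        rw [← e1]; simp only [pr_cons, ← mul_assoc]
        rw [sT_comm (by omega)]
      have a2 := hK _ eK.symm
      exact key _ _ (rd_of_len h1 e1 (by simp at *; omega)) e1
        (rd_of_len h1 e2 (by simp at *; omega)) (e2.trans e) (DD_comm K v (by omega))

/-- `v ≤ w` implies `v` is a subword product of any reduced word of `w`. -/
lemma DD_of_le {n : ℕ} {L : List ℕ} (hL : Rd n L) {v : Equiv.Perm (Fin n)}
    (h : bruhatLE n v (pr n L)) : DD n L v := by
  obtain ⟨M, K, h1, h2, h3⟩ := h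
  rw [rd_iff] at h1 h2
  exact DD_word _ K L rfl h2.1 hL h2.2 v ⟨M, h3, h1.2⟩

lemma le_of_sublist {n : ℕ} {M L : List ℕ} (hM : Rd n M) (hL : Rd n L) (h : M.Sublist L) :
    bruhatLE n (pr n M) (pr n L) :=
  ⟨M, L, (rd_iff _ _).2 ⟨hM, rfl⟩, (rd_iff _ _).2 ⟨hL, rfl⟩, h⟩

end Sub9


namespace Sub9

lemma PP_once {n k : ℕ} {U V : List ℕ} (h1 : 1 ≤ k) (h2 : k < n) (hU : k ∉ U) (hV : k ∉ V) :
    PP k k (pr n (U ++ k :: V)) := by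
  obtain ⟨a, ha⟩ := exists_val (pr n V) (show k - 1 < n by omega)
  refine ⟨a, (pr_lt hV a).1 (by omega), ?_⟩
  rw [pr_append, pr_cons, Equiv.Perm.mul_apply, Equiv.Perm.mul_apply]
  have := pr_lt hU (simpleT n k (pr n V a))
  rw [sT_val h1 h2, if_pos ha] at this
  omega

lemma nodup_split {k : ℕ} {L : List ℕ} (h : L.Nodup) (hk : k ∈ L) :
    ∃ U V, L = U ++ k :: V ∧ k ∉ U ∧ k ∉ V := by
  obtain ⟨U, V, rfl⟩ := List.append_of_mem hk
  refine ⟨U, V, rfl, ?_, ?_⟩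
  · intro h'
    rw [List.nodup_append] at h
    exact h.2.2 k h' k (by simp) rfl
  · intro h'
    rw [List.nodup_append, List.nodup_cons] at h
    exact h.2.1.1 h'

lemma PP_nodup {n k : ℕ} {L : List ℕ} (hv : ∀ k ∈ L, 1 ≤ k ∧ k < n) (h : L.Nodup) (hk : k ∈ L) :
    PP k k (pr n L) := by
  obtain ⟨U, V, rfl, h1, h2⟩ := nodup_split h hk
  exact PP_once (hv k hk).1 (hv k hk).2 h1 h2

lemma rd_nodup {n : ℕ} {L : List ℕ} (hv : ∀ k ∈ L, 1 ≤ k ∧ k < n) (h : L.Nodup) : Rd n L := by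
  intro M hM
  have hsub : L.toFinset ⊆ M.toFinset := by
    intro k hk
    rw [List.mem_toFinset] at *
    by_contra hkM
    have := PP_nodup hv h hk
    rw [← hM] at this
    exact not_PP hkM this
  calc L.length = L.toFinset.card := (List.toFinset_card_of_nodup h).symm
    _ ≤ M.toFinset.card := Finset.card_le_card hsub
    _ ≤ M.length := List.toFinset_card_le M

lemma PP_sand {n p q : ℕ} {A B : List ℕ} {g : Equiv.Perm (Fin n)} (hA : q ∉ A) (hB : p ∉ B) :
    PP p q (pr n A * g * pr n B) ↔ PP p q g := by
  constructor
  · rintro ⟨a, h1, h2⟩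
    refine ⟨pr n B a, (pr_lt hB a).2 h1, ?_⟩
    have := pr_lt hA (g (pr n B a))
    simp only [Equiv.Perm.mul_apply] at h2
    omega
  · rintro ⟨a, h1, h2⟩
    obtain ⟨b, rfl⟩ := (pr n B).surjective a
    refine ⟨b, (pr_lt hB b).1 h1, ?_⟩
    have := pr_lt hA (g (pr n B b))
    simp only [Equiv.Perm.mul_apply]
    omega

lemma QQ_sand {n p q : ℕ} {A B : List ℕ} {g : Equiv.Perm (Fin n)} (hA : q ∉ A) (hB : p ∉ B) :
    QQ p q (pr n A * g * pr n B) ↔ QQ p q g := by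
  constructor
  · rintro ⟨a, h1, h2⟩
    have h3 := pr_lt hB a
    refine ⟨pr n B a, by omega, ?_⟩
    have := pr_lt hA (g (pr n B a))
    simp only [Equiv.Perm.mul_apply] at h2
    omega
  · rintro ⟨a, h1, h2⟩
    obtain ⟨b, rfl⟩ := (pr n B).surjective a
    have h3 := pr_lt hB b
    refine ⟨b, by omega, ?_⟩
    have := pr_lt hA (g (pr n B b))
    simp only [Equiv.Perm.mul_apply]
    omega

lemma shift {n j : ℕ} (hj : j + 2 < n) {X : List ℕ} (hX : ∀ k ∈ X, k = 1 ∨ k = 2) :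
    (∀ x : Fin n, x.val < j ∨ j + 3 ≤ x.val → pr n (X.map (· + j)) x = x) ∧
    (∀ (y : Fin 3) (x : Fin n), x.val = j + y.val →
      (pr n (X.map (· + j)) x).val = j + (pr 3 X y).val) := by
  induction X with
  | nil => simp [pr]
  | cons k X ih =>
    have ih := ih (fun k hk => hX k (List.mem_cons_of_mem _ hk))
    have hk := hX k (by simp)
    rw [List.map_cons]
    constructor
    · intro x hx
      rw [pr_cons, Equiv.Perm.mul_apply, ih.1 x hx]
      ext
      rw [sT_val (by omega) (by omega)]
      split_ifs <;> omega
    · intro y x hxy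
      rw [pr_cons, pr_cons, Equiv.Perm.mul_apply, Equiv.Perm.mul_apply, sT_val (by omega) (by omega),
        sT_val (by omega) (by omega), ih.2 y x hxy]
      split_ifs <;> omega

lemma PP_shift {n j p q : ℕ} (hj : j + 2 < n) (hp : p ≤ 3) {X : List ℕ}
    (hX : ∀ k ∈ X, k = 1 ∨ k = 2) (hq : 1 ≤ q) :
    PP (j + p) (j + q) (pr n (X.map (· + j))) ↔ PP p q (pr 3 X) := by
  obtain ⟨s1, s2⟩ := shift hj hX
  constructor
  · rintro ⟨a, h1, h2⟩
    by_cases ha : a.val < j ∨ j + 3 ≤ a.val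
    · rw [s1 a ha] at h2; omega
    · have := s2 ⟨a.val - j, by omega⟩ a (by simp; omega)
      exact ⟨⟨a.val - j, by omega⟩, by simp; omega, by omega⟩
  · rintro ⟨a, h1, h2⟩
    have := s2 a ⟨j + a.val, by omega⟩ rfl
    exact ⟨⟨j + a.val, by omega⟩, by simp; omega, by omega⟩

lemma QQ_shift {n j p q : ℕ} (hj : j + 2 < n) (hq : q ≤ 3) {X : List ℕ}
    (hX : ∀ k ∈ X, k = 1 ∨ k = 2) (hp : 1 ≤ p) :
    QQ (j + p) (j + q) (pr n (X.map (· + j))) ↔ QQ p q (pr 3 X) := by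
  obtain ⟨s1, s2⟩ := shift hj hX
  constructor
  · rintro ⟨a, h1, h2⟩
    by_cases ha : a.val < j ∨ j + 3 ≤ a.val
    · rw [s1 a ha] at h2; omega
    · have := s2 ⟨a.val - j, by omega⟩ a (by simp; omega)
      exact ⟨⟨a.val - j, by omega⟩, by simp; omega, by omega⟩
  · rintro ⟨a, h1, h2⟩
    have := s2 a ⟨j + a.val, by omega⟩ rfl
    exact ⟨⟨j + a.val, by omega⟩, by simp; omega, by omega⟩

/-- canonical reduced words in `S₃` -/
def wd (u : Equiv.Perm (Fin 3)) : List ℕ :=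
  if u 0 = 0 then (if u 1 = 1 then [] else [2])
  else if u 0 = 1 then (if u 1 = 0 then [1] else [1, 2])
  else if u 1 = 0 then [2, 1] else [1, 2, 1]

lemma wd_pr (u : Equiv.Perm (Fin 3)) : pr 3 (wd u) = u := by
  revert u; decide

lemma wd_mem (u : Equiv.Perm (Fin 3)) : ∀ k ∈ wd u, k = 1 ∨ k = 2 := by
  revert u; decide

lemma wd_cases (u : Equiv.Perm (Fin 3)) : (wd u).Nodup ∨
    (wd u = [1, 2, 1] ∧ PP 1 1 u ∧ PP 2 2 u ∧ PP 1 2 u ∧ QQ 2 1 u) := by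
  revert u; decide

lemma wd_sub (u v : Equiv.Perm (Fin 3)) (h1 : PP 1 1 u → PP 1 1 v) (h2 : PP 2 2 u → PP 2 2 v)
    (h3 : PP 1 2 u → PP 1 2 v) (h4 : QQ 2 1 u → QQ 2 1 v) : (wd u).Sublist (wd v) := by
  have dl : ∀ {a b : Prop} [Decidable a] [Decidable b], (a → b) → decide a ≤ decide b := by
    intro a b _ _ h
    by_cases ha : a
    · simp [ha, h ha]
    · simp [ha]
  have key : ∀ u v : Equiv.Perm (Fin 3), (decide (PP 1 1 u) ≤ decide (PP 1 1 v) ∧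
      decide (PP 2 2 u) ≤ decide (PP 2 2 v) ∧ decide (PP 1 2 u) ≤ decide (PP 1 2 v) ∧
      decide (QQ 2 1 u) ≤ decide (QQ 2 1 v)) → (wd u).Sublist (wd v) := by decide
  exact key u v ⟨dl h1, dl h2, dl h3, dl h4⟩

lemma wd_anti {u v : Equiv.Perm (Fin 3)} (h1 : (wd u).Sublist (wd v))
    (h2 : (wd v).Sublist (wd u)) : u = v := by
  rw [← wd_pr u, ← wd_pr v, h1.antisymm h2]

lemma word_PP {n j p q : ℕ} (hj : j + 2 < n) {A B : List ℕ}
    (hA : ∀ k ∈ A, k ≠ j + 1 ∧ k ≠ j + 2) (hB : ∀ k ∈ B, k ≠ j + 1 ∧ k ≠ j + 2)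
    (hp : p = 1 ∨ p = 2) (hq : q = 1 ∨ q = 2) (u : Equiv.Perm (Fin 3)) :
    PP (j + p) (j + q) (pr n (A ++ (wd u).map (· + j) ++ B)) ↔ PP p q u := by
  rw [pr_append, pr_append, PP_sand, PP_shift hj (by omega) (wd_mem u) (by omega), wd_pr]
  · intro h; have := hA _ h; omega
  · intro h; have := hB _ h; omega

lemma word_QQ {n j p q : ℕ} (hj : j + 2 < n) {A B : List ℕ}
    (hA : ∀ k ∈ A, k ≠ j + 1 ∧ k ≠ j + 2) (hB : ∀ k ∈ B, k ≠ j + 1 ∧ k ≠ j + 2)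
    (hp : p = 1 ∨ p = 2) (hq : q = 1 ∨ q = 2) (u : Equiv.Perm (Fin 3)) :
    QQ (j + p) (j + q) (pr n (A ++ (wd u).map (· + j) ++ B)) ↔ QQ p q u := by
  rw [pr_append, pr_append, QQ_sand, QQ_shift hj (by omega) (wd_mem u) (by omega), wd_pr]
  · intro h; have := hA _ h; omega
  · intro h; have := hB _ h; omega

lemma word_rd {n j : ℕ} (hj : j + 2 < n) {A B : List ℕ}
    (hA : ∀ k ∈ A ++ B, (1 ≤ k ∧ k < n) ∧ k ≠ j + 1 ∧ k ≠ j + 2)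
    (hN : (A ++ B).Nodup) (u : Equiv.Perm (Fin 3)) :
    Rd n (A ++ (wd u).map (· + j) ++ B) := by
  have hA1 : ∀ k ∈ A, k ≠ j + 1 ∧ k ≠ j + 2 := fun k hk => (hA k (by simp [hk])).2
  have hB1 : ∀ k ∈ B, k ≠ j + 1 ∧ k ≠ j + 2 := fun k hk => (hA k (by simp [hk])).2
  rcases wd_cases u with h | ⟨h, p11, p22, p12, q21⟩
  · apply rd_nodup
    · intro k hk
      simp only [List.mem_append, List.mem_map] at hk
      rcases hk with (hk | ⟨x, hx, rfl⟩) | hk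
      · exact (hA k (by simp [hk])).1
      · have := wd_mem u x hx
        omega
      · exact (hA k (by simp [hk])).1
    · rw [List.append_assoc]
      apply List.Perm.nodup_iff (l₁ := (wd u).map (· + j) ++ (A ++ B)) ?_ |>.1
      · rw [List.nodup_append]
        refine ⟨h.map (fun a b hab => by simpa using hab), hN, ?_⟩
        intro a ha b hb
        obtain ⟨x, hx, rfl⟩ := List.mem_map.1 ha
        have := wd_mem u x hx
        have := hA b hb
        omega
      · rw [← List.append_assoc, ← List.append_assoc]
        exact List.Perm.append_right _ List.perm_append_comm
  · rw [← word_PP hj hA1 hB1 (by simp) (by simp)] at p11 p22 p12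
    rw [← word_QQ hj hA1 hB1 (by simp) (by simp)] at q21
    intro M hM
    rw [← hM] at p11 p22 p12 q21
    have m1 : j + 1 ∈ M := by
      by_contra hk; exact not_PP hk p11
    have m2 : j + 2 ∈ M := by
      by_contra hk; exact not_PP hk p22
    have mk : ∀ k ∈ A ++ B, k ∈ M := by
      intro k hk
      by_contra hkM
      apply not_PP (n := n) hkM
      rw [hM]
      have hkk := hA k hk
      have hkw : k ∉ (wd u).map (· + j) := by
        intro h
        obtain ⟨x, hx, rfl⟩ := List.mem_map.1 h
        have := wd_mem u x hx
        omega
      obtain ⟨U, V, e, hU, hV⟩ := nodup_split hN hk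
      rcases List.append_eq_append_iff.1 e with ⟨C, rfl, e2⟩ | ⟨C, rfl, e2⟩
      · have : A ++ (wd u).map (· + j) ++ B = (A ++ (wd u).map (· + j) ++ C) ++ k :: V := by
          rw [e2]; simp
        rw [this]
        refine PP_once hkk.1.1 hkk.1.2 ?_ hV
        simp only [List.mem_append, not_or] at hU ⊢
        exact ⟨⟨hU.1, hkw⟩, hU.2⟩
      · rcases C with _ | ⟨c, C⟩
        · simp only [List.nil_append] at e2
          subst e2
          have : U ++ [] ++ (wd u).map (· + j) ++ k :: V = (U ++ (wd u).map (· + j)) ++ k :: V := by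
            simp
          rw [this]
          refine PP_once hkk.1.1 hkk.1.2 ?_ hV
          simp only [List.mem_append, not_or] at hU ⊢
          exact ⟨hU, hkw⟩
        · simp only [List.cons_append, List.cons.injEq] at e2
          obtain ⟨rfl, rfl⟩ := e2
          have : U ++ k :: C ++ (wd u).map (· + j) ++ B =
            U ++ k :: (C ++ (wd u).map (· + j) ++ B) := by simp
          rw [this]
          refine PP_once hkk.1.1 hkk.1.2 hU ?_
          simp only [List.mem_append, not_or] at hV ⊢
          exact ⟨⟨hV.1, hkw⟩, hV.2⟩
    have hL : ((j + 1) :: (j + 2) :: (A ++ B)).Nodup := by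
      rw [List.nodup_cons, List.nodup_cons]
      refine ⟨?_, ?_, hN⟩
      · intro h
        rcases List.mem_cons.1 h with h | h
        · omega
        · have := hA _ h; omega
      · intro h; have := hA _ h; omega
    have hsub : ((j + 1) :: (j + 2) :: (A ++ B)).toFinset ⊆ M.toFinset := by
      intro k hk
      rw [List.mem_toFinset] at *
      rcases List.mem_cons.1 hk with rfl | hk
      · exact m1
      rcases List.mem_cons.1 hk with rfl | hk
      · exact m2
      exact mk k hk
    have c1 := Finset.card_le_card hsub
    rw [List.toFinset_card_of_nodup hL] at c1
    have c2 := List.toFinset_card_le M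
    by_contra hlt
    have hMN : M.Nodup := by
      apply (Multiset.toFinset_card_eq_card_iff_nodup (m := (M : Multiset ℕ))).1
      have : (M : Multiset ℕ).toFinset.card = M.toFinset.card := rfl
      rw [this]
      simp [h] at *
      omega
    obtain ⟨U, V, rfl, hU, hV⟩ := nodup_split hMN m1
    by_cases h2 : j + 2 ∈ U
    · have h3 : j + 2 ∉ ((j + 1) :: V) := by
        intro h3
        rw [List.nodup_append] at hMN
        exact hMN.2.2 _ h2 _ h3 rfl
      obtain ⟨a, ha1, ha2⟩ := q21
      rw [pr_append, Equiv.Perm.mul_apply, pr_lt hU] at ha2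
      have := pr_lt h3 a
      omega
    · have h3 : j + 2 ∉ U ++ [j + 1] := by simp [h2]
      obtain ⟨a, ha1, ha2⟩ := p12
      rw [show U ++ (j + 1) :: V = (U ++ [j + 1]) ++ V by simp, pr_append,
        Equiv.Perm.mul_apply] at ha2
      have := pr_lt h3 (pr n V a)
      have := pr_lt hV a
      omega

lemma wd_rd (u : Equiv.Perm (Fin 3)) : Rd 3 (wd u) := by
  have := word_rd (n := 3) (j := 0) (by omega) (A := []) (B := []) (by simp) (by simp) u
  simpa using this

lemma b3 (u v : Equiv.Perm (Fin 3)) : bruhatLE 3 u v ↔ (wd u).Sublist (wd v) := by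
  constructor
  · intro h
    exact wd_sub u v (PP_le h) (PP_le h) (PP_le h) (QQ_le h)
  · intro h
    have := le_of_sublist (wd_rd u) (wd_rd v) h
    rwa [wd_pr, wd_pr] at this

/-- the normal form -/
def FC (n : ℕ) (w : Equiv.Perm (Fin n)) : Prop :=
  ∃ (A B : List ℕ) (j : ℕ), j + 2 < n ∧
    (∀ k ∈ A ++ B, (1 ≤ k ∧ k < n) ∧ k ≠ j + 1 ∧ k ≠ j + 2) ∧ (A ++ B).Nodup ∧
    w = pr n (A ++ [j + 1, j + 2, j + 1] ++ B)

lemma sub_filter {A M : List ℕ} (hA : A.Nodup) (h : M.Sublist A) : A.filter (· ∈ M) = M := by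
  induction h with
  | slnil => rfl
  | @cons M A k hs ih =>
    rw [List.nodup_cons] at hA
    rw [List.filter_cons, if_neg, ih hA.2]
    simp only [decide_eq_true_eq]
    exact fun h => hA.1 (hs.subset h)
  | @cons_cons M A k hs ih =>
    rw [List.nodup_cons] at hA
    rw [List.filter_cons, if_pos (by simp)]
    congr 1
    refine Eq.trans ?_ (ih hA.2)
    apply List.filter_congr
    intro x hx
    have : x ≠ k := by rintro rfl; exact hA.1 hx
    simp [this]

lemma X_word {n j : ℕ} {X : List ℕ} (h : X.Sublist [j + 1, j + 2, j + 1]) :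
    ∃ u, pr n X = pr n ((wd u).map (· + j)) := by
  have : ∃ Y : List ℕ, Y.Sublist [1, 2, 1] ∧ X = Y.map (· + j) := by
    have e : [j + 1, j + 2, j + 1] = [1, 2, 1].map (· + j) := by simp [add_comm]
    rw [e] at h
    obtain ⟨Y, h1, h2⟩ := List.sublist_map_iff.1 h
    exact ⟨Y, h1, h2⟩
  obtain ⟨Y, hY, rfl⟩ := this
  rw [← List.mem_sublists] at hY
  have h2 : Y = [1, 1] ∨ Y = wd (pr 3 Y) := by
    revert hY
    have : ∀ Y ∈ List.sublists [1, 2, 1], Y = [1, 1] ∨ Y = wd (pr 3 Y) := by decide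
    exact this Y
  rcases h2 with rfl | h2
  · refine ⟨1, ?_⟩
    have : wd 1 = [] := by decide
    rw [this]
    simp [pr, sT_sq]
  · exact ⟨_, congrArg (fun Z => pr n (List.map (· + j) Z)) h2⟩

theorem iso_of_FC {n : ℕ} {w : Equiv.Perm (Fin n)} (h : FC n w) : Nonempty
        ((fun x y : {v : Equiv.Perm (Fin n) // bruhatLE n v w} => bruhatLE n x.1 y.1) ≃r
          (fun p q : Equiv.Perm (Fin 3) × Finset (Fin (permLen n w - 3)) =>
            bruhatLE 3 p.1 q.1 ∧ p.2 ⊆ q.2)) := by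
  obtain ⟨A, B, j, hj, hAB, hN, rfl⟩ := h
  have htop : wd (Equiv.swap 0 2) = [1, 2, 1] := by decide
  have htop' : [j + 1, j + 2, j + 1] = (wd (Equiv.swap 0 2)).map (· + j) := by
    rw [htop]; simp [add_comm]
  have hrd0 : Rd n (A ++ [j + 1, j + 2, j + 1] ++ B) := by
    rw [htop']; exact word_rd hj hAB hN _
  have hlen : permLen n (pr n (A ++ [j + 1, j + 2, j + 1] ++ B)) - 3 = (A ++ B).length := by
    rw [rd_len hrd0]; simp; omega
  rw [hlen]
  let img : Finset (Fin (A ++ B).length) → Finset ℕ := fun S => S.image (A ++ B).get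
  let W : Equiv.Perm (Fin 3) → Finset ℕ → List ℕ := fun u T =>
    A.filter (· ∈ T) ++ (wd u).map (· + j) ++ B.filter (· ∈ T)
  have hginj : Function.Injective (A ++ B).get := List.nodup_iff_injective_get.1 hN
  have hfsub : ∀ T : Finset ℕ, (A.filter (· ∈ T) ++ B.filter (· ∈ T)).Sublist (A ++ B) := fun T =>
    List.Sublist.append List.filter_sublist List.filter_sublist
  have hrd : ∀ u T, Rd n (W u T) := fun u T => word_rd hj
    (fun k hk => hAB k ((hfsub T).subset hk)) (hN.sublist (hfsub T)) u
  have hsub0 : ∀ u T, (W u T).Sublist (A ++ [j + 1, j + 2, j + 1] ++ B) := by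
    intro u T
    refine List.Sublist.append (List.Sublist.append List.filter_sublist ?_) List.filter_sublist
    rw [htop']
    apply List.Sublist.map
    revert u; decide
  let f : Equiv.Perm (Fin 3) × Finset (Fin (A ++ B).length) →
      {v : Equiv.Perm (Fin n) // bruhatLE n v (pr n (A ++ [j + 1, j + 2, j + 1] ++ B))} :=
    fun p => ⟨pr n (W p.1 (img p.2)), le_of_sublist (hrd _ _) hrd0 (hsub0 _ _)⟩
  have hA1 : ∀ T : Finset ℕ, ∀ k ∈ A.filter (· ∈ T), k ≠ j + 1 ∧ k ≠ j + 2 := fun T k hk =>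
    (hAB k (by simp [(List.mem_filter.1 hk).1])).2
  have hB1 : ∀ T : Finset ℕ, ∀ k ∈ B.filter (· ∈ T), k ≠ j + 1 ∧ k ≠ j + 2 := fun T k hk =>
    (hAB k (by simp [(List.mem_filter.1 hk).1])).2
  have hrel : ∀ p q, bruhatLE n (f p).1 (f q).1 ↔ bruhatLE 3 p.1 q.1 ∧ p.2 ⊆ q.2 := by
    rintro ⟨u, S⟩ ⟨v, T⟩
    constructor
    · intro h
      constructor
      · rw [b3]
        apply wd_sub
        · have := PP_le (p := j + 1) (q := j + 1) h
          simpa only [f, W, word_PP hj (hA1 _) (hB1 _) (p := 1) (q := 1) (by simp) (by simp)]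
            using this
        · have := PP_le (p := j + 2) (q := j + 2) h
          simpa only [f, W, word_PP hj (hA1 _) (hB1 _) (p := 2) (q := 2) (by simp) (by simp)]
            using this
        · have := PP_le (p := j + 1) (q := j + 2) h
          simpa only [f, W, word_PP hj (hA1 _) (hB1 _) (p := 1) (q := 2) (by simp) (by simp)]
            using this
        · have := QQ_le (p := j + 2) (q := j + 1) h
          simpa only [f, W, word_QQ hj (hA1 _) (hB1 _) (p := 2) (q := 1) (by simp) (by simp)]
            using this
      · intro k hk
        have hk' : (A ++ B).get k ∈ img S := Finset.mem_image_of_mem _ hk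
        have hkm : (A ++ B).get k ∈ A ++ B := List.get_mem _ _
        have hne := (hAB _ hkm).2
        have m1 : (A ++ B).get k ∈ W u (img S) := by
          simp only [W, List.mem_append, List.mem_filter, hk', decide_true, and_true]
          rcases List.mem_append.1 hkm with h | h
          · exact Or.inl (Or.inl h)
          · exact Or.inr h
        rw [mem_iff_PP (hrd _ _)] at m1
        have m2 := PP_le h m1
        simp only [f] at m2
        rw [← mem_iff_PP (hrd _ _)] at m2
        simp only [W, List.mem_append, List.mem_filter, decide_eq_true_eq, List.mem_map] at m2
        have : (A ++ B).get k ∈ img T := by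
          rcases m2 with (h | ⟨x, hx, h⟩) | h
          · exact h.2
          · have := wd_mem v x hx
            omega
          · exact h.2
        obtain ⟨k', hk1, hk2⟩ := Finset.mem_image.1 this
        rwa [← hginj hk2]
    · rintro ⟨h1, h2⟩
      rw [b3] at h1
      refine le_of_sublist (hrd _ _) (hrd _ _) ?_
      have hi : img S ⊆ img T := Finset.image_subset_image h2
      refine List.Sublist.append (List.Sublist.append ?_ (h1.map _)) ?_
      · apply List.monotone_filter_right
        intro a ha
        simp only [decide_eq_true_eq] at *
        exact hi ha
      · apply List.monotone_filter_right
        intro a ha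
        simp only [decide_eq_true_eq] at *
        exact hi ha
  have hfinj : Function.Injective f := by
    rintro ⟨u, S⟩ ⟨v, T⟩ e
    have hrefl : ∀ p, bruhatLE n (f p).1 (f p).1 := fun p =>
      le_of_sublist (hrd _ _) (hrd _ _) (List.Sublist.refl _)
    have a1 := (hrel ⟨u, S⟩ ⟨v, T⟩).1 (by rw [e]; exact hrefl _)
    have a2 := (hrel ⟨v, T⟩ ⟨u, S⟩).1 (by rw [e]; exact hrefl _)
    simp only [b3] at a1 a2
    rw [Prod.mk.injEq]
    exact ⟨wd_anti a1.1 a2.1, a1.2.antisymm a2.2⟩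
  have hfsurj : Function.Surjective f := by
    rintro ⟨v, hv⟩
    obtain ⟨M, hM, rfl⟩ := DD_of_le hrd0 hv
    obtain ⟨M1, B', rfl, h1, hB'⟩ := List.sublist_append_iff.1 hM
    obtain ⟨A', X, rfl, hA', hX⟩ := List.sublist_append_iff.1 h1
    obtain ⟨u, hu⟩ := X_word (n := n) hX
    refine ⟨⟨u, Finset.univ.filter (fun k => (A ++ B).get k ∈ A' ++ B')⟩, Subtype.ext ?_⟩
    have himg : ∀ k ∈ A ++ B, (k ∈ img (Finset.univ.filter (fun k => (A ++ B).get k ∈ A' ++ B')) ↔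
        k ∈ A' ++ B') := by
      intro k hk
      simp only [img, Finset.mem_image, Finset.mem_filter, Finset.mem_univ, true_and]
      constructor
      · rintro ⟨i, h, rfl⟩; exact h
      · intro h
        obtain ⟨i, rfl⟩ := List.get_of_mem hk
        exact ⟨i, h, rfl⟩
    have hd : ∀ a ∈ A, ∀ b ∈ B, a ≠ b := (List.nodup_append.1 hN).2.2
    have eA : A.filter (· ∈ img (Finset.univ.filter (fun k => (A ++ B).get k ∈ A' ++ B'))) = A' := by
      refine Eq.trans ?_ (sub_filter (List.nodup_append.1 hN).1 hA')
      apply List.filter_congr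
      intro x hx
      simp only [himg x (by simp [hx])]
      have : x ∉ B' := fun h => hd x hx x (hB'.subset h) rfl
      simp [this]
    have eB : B.filter (· ∈ img (Finset.univ.filter (fun k => (A ++ B).get k ∈ A' ++ B'))) = B' := by
      refine Eq.trans ?_ (sub_filter (List.nodup_append.1 hN).2.1 hB')
      apply List.filter_congr
      intro x hx
      simp only [himg x (by simp [hx])]
      have : x ∉ A' := fun h => hd x (hA'.subset h) x hx rfl
      simp [this]
    simp only [f, W]
    rw [eA, eB, pr_append, pr_append, pr_append, pr_append, hu]
  exact ⟨(RelIso.mk (Equiv.ofBijective f ⟨hfinj, hfsurj⟩) (fun {a b} => hrel a b)).symm⟩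

end Sub9


namespace Sub9

lemma dup_split {L : List ℕ} (h : ¬ L.Nodup) : ∃ A i C B, L = A ++ i :: C ++ i :: B := by
  induction L with
  | nil => simp at h
  | cons a L ih =>
    by_cases ha : a ∈ L
    · obtain ⟨C, B, rfl⟩ := List.append_of_mem ha
      exact ⟨[], a, C, B, by simp⟩
    · obtain ⟨A, i, C, B, rfl⟩ := ih (fun h' => h (List.nodup_cons.2 ⟨ha, h'⟩))
      exact ⟨a :: A, i, C, B, by simp⟩

lemma comm_list {n i : ℕ} {C : List ℕ} (h : ∀ k ∈ C, k + 1 < i ∨ i + 1 < k) :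
    simpleT n i * pr n C = pr n C * simpleT n i := by
  induction C with
  | nil => simp [pr]
  | cons k C ih =>
    rw [pr_cons, ← mul_assoc, sT_comm (n := n) (s := i) (t := k)
      (by have := h k (by simp); omega), mul_assoc, ih (fun k hk => h k (by simp [hk])), mul_assoc]

lemma noncomm {n i : ℕ} (h1 : 1 ≤ i) (h2 : i + 1 < n) : pr n [i, i + 1] ≠ pr n [i + 1, i] := by
  intro h
  have := congrArg (fun g : Equiv.Perm (Fin n) => (g ⟨i - 1, by omega⟩).val) h
  simp only [pr_cons, pr_nil, mul_one, Equiv.Perm.mul_apply, sT_val h1 (show i < n by omega),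
    sT_val (show 1 ≤ i + 1 by omega) h2] at this
  simp at this
  split_ifs at this <;> omega

lemma FC_of_word {n i : ℕ} {A C B : List ℕ} (hW : Rd n (A ++ i :: C ++ i :: B))
    (hN : (A ++ i :: C ++ B).Nodup) (hC : ¬ (i + 1 ∈ C ∧ i - 1 ∈ C)) :
    FC n (pr n (A ++ i :: C ++ i :: B)) := by
  have hv := rd_valid' hW
  have hCne : ∀ k ∈ C, k ≠ i := by
    rintro k hk rfl
    rw [List.append_assoc, List.nodup_append, List.cons_append, List.nodup_cons] at hN
    exact hN.2.1.1 (by simp [hk])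
  have hCN : C.Nodup := by
    rw [List.append_assoc, List.nodup_append, List.cons_append, List.nodup_cons,
      List.nodup_append] at hN
    exact hN.2.1.2.1
  by_cases h0 : i + 1 ∉ C ∧ i - 1 ∉ C
  · exfalso
    have hc : simpleT n i * pr n C = pr n C * simpleT n i := by
      apply comm_list
      intro k hk
      have := hCne k hk
      have a1 : k ≠ i + 1 := by rintro rfl; exact h0.1 hk
      have a2 : k ≠ i - 1 := by rintro rfl; exact h0.2 hk
      omega
    have := hW (A ++ C ++ B) (by
      simp only [pr_append, pr_cons]
      rw [hc]
      simp only [mul_assoc]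
      rw [← mul_assoc (simpleT n i) (simpleT n i), sT_sq, one_mul])
    simp only [List.length_append, List.length_cons] at this
    omega
  have main : ∀ x ∈ C, (x = i + 1 ∨ x + 1 = i) → (∀ k ∈ C, k ≠ x → k + 1 < i ∨ i + 1 < k) →
      FC n (pr n (A ++ i :: C ++ i :: B)) := by
    intro x hx hxi hk
    obtain ⟨C1, C2, rfl, hC1, hC2⟩ := nodup_split hCN hx
    have hc1 : simpleT n i * pr n C1 = pr n C1 * simpleT n i := comm_list (fun k hk' =>
      hk k (by simp [hk']) (by rintro rfl; exact hC1 hk'))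
    have hc2 : simpleT n i * pr n C2 = pr n C2 * simpleT n i := comm_list (fun k hk' =>
      hk k (by simp [hk']) (by rintro rfl; exact hC2 hk'))
    have e : pr n (A ++ i :: (C1 ++ x :: C2) ++ i :: B) =
        pr n ((A ++ C1) ++ [i, x, i] ++ (C2 ++ B)) := by
      have c1 : ∀ g, simpleT n i * (pr n C1 * g) = pr n C1 * (simpleT n i * g) := fun g => by
        rw [← mul_assoc, hc1, mul_assoc]
      have c2 : ∀ g, simpleT n i * (pr n C2 * g) = pr n C2 * (simpleT n i * g) := fun g => by
        rw [← mul_assoc, hc2, mul_assoc]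
      simp only [pr_append, pr_cons, pr_nil, mul_assoc, mul_one, one_mul, c1, c2]
    have hP : (A ++ i :: (C1 ++ x :: C2) ++ B).Perm (i :: x :: ((A ++ C1) ++ (C2 ++ B))) := by
      rw [List.perm_iff_count]
      intro a
      simp only [List.count_append, List.count_cons]
      omega
    have hN' := hP.nodup_iff.1 hN
    rw [List.nodup_cons, List.nodup_cons] at hN'
    have hval : ∀ k ∈ (A ++ C1) ++ (C2 ++ B), 1 ≤ k ∧ k < n := by
      intro k hk
      apply hv
      simp only [List.mem_append, List.mem_cons] at hk ⊢
      tauto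
    have hi := hv i (by simp)
    have hxv := hv x (by simp)
    have hkne : ∀ k ∈ (A ++ C1) ++ (C2 ++ B), k ≠ i ∧ k ≠ x := by
      intro k hk'
      constructor
      · rintro rfl; exact hN'.1 (List.mem_cons_of_mem _ hk')
      · rintro rfl; exact hN'.2.1 hk'
    rcases hxi with rfl | rfl
    · refine ⟨A ++ C1, C2 ++ B, i - 1, by omega, ?_, hN'.2.2, ?_⟩
      · intro k hk
        have := hkne k hk
        exact ⟨hval k hk, by omega, by omega⟩
      · rw [e]
        rw [show i - 1 + 1 = i by omega, show i - 1 + 2 = i + 1 by omega]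
    · refine ⟨A ++ C1, C2 ++ B, x - 1, by omega, ?_, hN'.2.2, ?_⟩
      · intro k hk
        have := hkne k hk
        exact ⟨hval k hk, by omega, by omega⟩
      · rw [e]
        rw [show x - 1 + 1 = x by omega, show x - 1 + 2 = x + 1 by omega]
        have := sT_braid (n := n) hxv.1 hi.2
        have h3 : pr n [x + 1, x, x + 1] = pr n [x, x + 1, x] := by
          simp only [pr_cons, pr_nil, mul_one]
          rw [← mul_assoc, ← mul_assoc, this]
        rw [pr_append, pr_append _ (A ++ C1), h3, ← pr_append, ← pr_append]
  by_cases h1 : i + 1 ∈ C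
  · refine main _ h1 (Or.inl rfl) ?_
    intro k hk hk'
    have := hCne k hk
    have a2 : k ≠ i - 1 := by rintro rfl; exact hC ⟨h1, hk⟩
    omega
  · have h2 : i - 1 ∈ C := by tauto
    have := hv (i - 1) (by simp [h2])
    refine main _ h2 (Or.inr (by omega)) ?_
    intro k hk hk'
    have := hCne k hk
    have a2 : k ≠ i + 1 := by rintro rfl; exact h1 hk
    omega

lemma lt_len {n : ℕ} {v w : Equiv.Perm (Fin n)} (h : bruhatLE n v w) (hne : v ≠ w) :
    permLen n v < permLen n w := by
  obtain ⟨M, L, h1, h2, h3⟩ := h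
  rw [← h1.2, ← h2.2]
  refine lt_of_le_of_ne h3.length_le (fun e => hne ?_)
  rw [← h1.1, ← h2.1, h3.eq_of_length e]

lemma le_refl' {n : ℕ} {v w : Equiv.Perm (Fin n)} (h : bruhatLE n v w) : bruhatLE n v v := by
  obtain ⟨M, L, h1, h2, h3⟩ := h
  exact ⟨M, M, h1, h1, List.Sublist.refl _⟩

lemma exists_word {n : ℕ} {v w : Equiv.Perm (Fin n)} (h : bruhatLE n v w) :
    ∃ M, Rd n M ∧ pr n M = v := by
  obtain ⟨M, L, h1, h2, h3⟩ := h
  exact ⟨M, (rd_iff _ _).1 h1⟩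

lemma rd_nil (n : ℕ) : Rd n [] := fun M _ => by simp

lemma pr_single (n k : ℕ) : pr n [k] = simpleT n k := by simp [pr]

lemma s_le_iff {n k : ℕ} {M : List ℕ} (hM : Rd n M) (hk : 1 ≤ k ∧ k < n) :
    bruhatLE n (simpleT n k) (pr n M) ↔ k ∈ M := by
  rw [← pr_single]
  constructor
  · intro h
    exact (mem_iff_PP hM).2 (PP_le h (PP_single hk.1 hk.2))
  · intro h
    exact le_of_sublist (rd_single hk.1 hk.2) hM (List.singleton_sublist.2 h)

lemma s_inj {n k l : ℕ} (hk : 1 ≤ k ∧ k < n) (h : simpleT n k = simpleT n l) : k = l := by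
  have := PP_single hk.1 hk.2
  rw [pr_single, h, ← pr_single] at this
  by_contra hne
  exact not_PP (by simpa using hne) this

lemma s_ne_one {n k : ℕ} (hk : 1 ≤ k ∧ k < n) : simpleT n k ≠ 1 := by
  intro h
  have := PP_single hk.1 hk.2
  rw [pr_single, h, ← pr_nil] at this
  exact not_PP (by simp) this

def At {α : Type} (r : α → α → Prop) (b x : α) : Prop := x ≠ b ∧ ∀ y, r y x → y = b ∨ y = x

abbrev RR (m : ℕ) := fun p q : Equiv.Perm (Fin 3) × Finset (Fin m) =>
  bruhatLE 3 p.1 q.1 ∧ p.2 ⊆ q.2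

abbrev t1 : Equiv.Perm (Fin 3) := Equiv.swap 0 1
abbrev t2 : Equiv.Perm (Fin 3) := Equiv.swap 1 2

lemma b3_bot (u : Equiv.Perm (Fin 3)) : bruhatLE 3 1 u := by
  rw [b3]; revert u; decide
lemma b3_le1 (u : Equiv.Perm (Fin 3)) : bruhatLE 3 u 1 → u = 1 := by
  rw [b3]; revert u; decide
lemma b3_t1 (u : Equiv.Perm (Fin 3)) : bruhatLE 3 u t1 → u = 1 ∨ u = t1 := by
  rw [b3]; revert u; decide
lemma b3_t2 (u : Equiv.Perm (Fin 3)) : bruhatLE 3 u t2 → u = 1 ∨ u = t2 := by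
  rw [b3]; revert u; decide
lemma b3_ne (u : Equiv.Perm (Fin 3)) : u ≠ 1 → bruhatLE 3 t1 u ∨ bruhatLE 3 t2 u := by
  rw [b3, b3]; revert u; decide
lemma b3_same (u v : Equiv.Perm (Fin 3)) (h : u ≠ v) (h1 : bruhatLE 3 t1 u ↔ bruhatLE 3 t1 v)
    (h2 : bruhatLE 3 t2 u ↔ bruhatLE 3 t2 v) : bruhatLE 3 t1 u ∧ bruhatLE 3 t2 u := by
  simp only [b3] at *; revert u v; decide

lemma t1_ne : ¬ (t1 = 1) := by decide
lemma t2_ne : ¬ (t2 = 1) := by decide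
lemma t12_ne : ¬ (t1 = t2) := by decide

lemma right_at {m : ℕ} (p : Equiv.Perm (Fin 3) × Finset (Fin m)) :
    At (RR m) (1, ∅) p ↔ p = (t1, ∅) ∨ p = (t2, ∅) ∨ ∃ k, p = (1, {k}) := by
  obtain ⟨u, S⟩ := p
  constructor
  · rintro ⟨h1, h2⟩
    by_cases hS : S.Nonempty
    · obtain ⟨k, hk⟩ := hS
      rcases h2 (1, {k}) ⟨b3_bot _, by simpa using hk⟩ with h | h
      · simp at h
      · exact Or.inr (Or.inr ⟨k, h.symm⟩)
    · rw [Finset.not_nonempty_iff_eq_empty] at hS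
      subst hS
      have hu : u ≠ 1 := by rintro rfl; exact h1 rfl
      rcases b3_ne u hu with h | h
      · rcases h2 (t1, ∅) ⟨h, by simp⟩ with h | h
        · exact absurd (congrArg Prod.fst h) t1_ne
        · exact Or.inl h.symm
      · rcases h2 (t2, ∅) ⟨h, by simp⟩ with h | h
        · exact absurd (congrArg Prod.fst h) t2_ne
        · exact Or.inr (Or.inl h.symm)
  · rintro (h | h | ⟨k, h⟩)
    · rw [h]
      refine ⟨fun h => absurd (congrArg Prod.fst h) t1_ne, ?_⟩
      rintro ⟨v, T⟩ ⟨h1, h2⟩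
      have : T = ∅ := by simpa using h2
      subst this
      rcases b3_t1 v h1 with rfl | rfl <;> simp
    · rw [h]
      refine ⟨fun h => absurd (congrArg Prod.fst h) t2_ne, ?_⟩
      rintro ⟨v, T⟩ ⟨h1, h2⟩
      have : T = ∅ := by simpa using h2
      subst this
      rcases b3_t2 v h1 with rfl | rfl <;> simp
    · rw [h]
      refine ⟨fun h => by simp at h, ?_⟩
      rintro ⟨v, T⟩ ⟨h1, h2⟩
      have := b3_le1 v h1
      subst this
      rcases Finset.subset_singleton_iff.1 h2 with h | h
      · left; exact Prod.ext rfl h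
      · right; exact Prod.ext rfl h

lemma right_card (m : ℕ) :
    Set.ncard {p : Equiv.Perm (Fin 3) × Finset (Fin m) | At (RR m) (1, ∅) p} = m + 2 := by
  obtain ⟨F, hF⟩ : ∃ F : Finset (Equiv.Perm (Fin 3) × Finset (Fin m)), F = insert (t1, ∅)
      (insert (t2, ∅) (Finset.univ.image (fun k : Fin m =>
        ((1 : Equiv.Perm (Fin 3)), ({k} : Finset (Fin m)))))) := ⟨_, rfl⟩
  have : {p : Equiv.Perm (Fin 3) × Finset (Fin m) | At (RR m) (1, ∅) p} = (F : Set _) := by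
    ext p
    rw [Set.mem_ofPred_eq, right_at, Finset.mem_coe, hF]
    simp only [Finset.mem_insert, Finset.mem_image, Finset.mem_univ, true_and]
    simp only [eq_comm]
  rw [this, Set.ncard_coe_finset, hF, Finset.card_insert_of_notMem, Finset.card_insert_of_notMem,
    Finset.card_image_of_injective]
  · simp
  · intro a b h
    simpa using h
  · simp
  · simp only [Finset.mem_insert, not_or, Finset.mem_image, Finset.mem_univ, true_and, not_exists]
    refine ⟨fun h => absurd (congrArg Prod.fst h) t12_ne, fun x h => ?_⟩
    simp at h

theorem FC_of_iso {n : ℕ} {w : Equiv.Perm (Fin n)}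
    (E : (fun x y : {v : Equiv.Perm (Fin n) // bruhatLE n v w} => bruhatLE n x.1 y.1) ≃r
          (fun p q : Equiv.Perm (Fin 3) × Finset (Fin (permLen n w - 3)) =>
            bruhatLE 3 p.1 q.1 ∧ p.2 ⊆ q.2)) : FC n w := by
  obtain ⟨W, hW, rfl⟩ : ∃ W, Rd n W ∧ pr n W = w := by
    obtain ⟨M, L, h1, h2, h3⟩ := (E.symm (1, ∅)).2
    exact ⟨L, (rd_iff _ _).1 h2⟩
  have hE : ∀ x y, RR _ (E x) (E y) ↔ bruhatLE n x.1 y.1 := fun x y => E.map_rel_iff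
  have hv := rd_valid' hW
  -- bottom
  have hbot : ∀ v w, bruhatLE n v w → bruhatLE n 1 v := by
    intro v w h
    obtain ⟨M, hM, rfl⟩ := exists_word h
    exact le_of_sublist (rd_nil n) hM (List.nil_sublist _)
  have h1w : bruhatLE n 1 (pr n W) := le_of_sublist (rd_nil n) hW (List.nil_sublist _)
  let o : {v : Equiv.Perm (Fin n) // bruhatLE n v (pr n W)} := ⟨1, h1w⟩
  have hEo : E o = (1, ∅) := by
    have : RR _ (E o) (E (E.symm (1, ∅))) := (hE _ _).2 (hbot _ _ (E.symm (1, ∅)).2)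
    rw [E.apply_symm_apply] at this
    obtain ⟨a, b⟩ := this
    have b' : (E o).2 = ∅ := by simpa using b
    exact Prod.ext (b3_le1 _ a) b'
  have hat : ∀ x, At (fun x y : {v : Equiv.Perm (Fin n) // bruhatLE n v (pr n W)} =>
      bruhatLE n x.1 y.1) o x ↔ At (RR _) (1, ∅) (E x) := by
    intro x
    constructor
    · rintro ⟨a, b⟩
      refine ⟨fun h => a (E.injective (h.trans hEo.symm)), fun y hy => ?_⟩
      obtain ⟨z, rfl⟩ := E.surjective y
      rcases b z ((hE _ _).1 hy) with h | h
      · left; rw [h, hEo]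
      · right; rw [h]
    · rintro ⟨a, b⟩
      refine ⟨fun h => a (by rw [h, hEo]), fun y hy => ?_⟩
      rcases b (E y) ((hE _ _).2 hy) with h | h
      · left; exact E.injective (h.trans hEo.symm)
      · right; exact E.injective h
  have hleft : ∀ x, At (fun x y : {v : Equiv.Perm (Fin n) // bruhatLE n v (pr n W)} =>
      bruhatLE n x.1 y.1) o x ↔ ∃ k ∈ W, simpleT n k = x.1 := by
    intro x
    constructor
    · rintro ⟨a, b⟩
      obtain ⟨M, hM, e⟩ := exists_word x.2
      rcases M with _ | ⟨k, M⟩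
      · exact absurd (Subtype.ext (by rw [← e]; rfl)) a
      · have hkv := rd_valid hM
        have hkx : bruhatLE n (simpleT n k) x.1 := by
          rw [← e, s_le_iff hM hkv]; simp
        have hkP : PP k k x.1 := by rw [← e, ← mem_iff_PP hM]; simp
        have hkW : k ∈ W := (mem_iff_PP hW).2 (PP_le x.2 hkP)
        refine ⟨k, hkW, ?_⟩
        rcases b ⟨simpleT n k, (s_le_iff hW hkv).2 hkW⟩ hkx with h | h
        · exact absurd (congrArg Subtype.val h) (s_ne_one hkv)
        · exact congrArg Subtype.val h
    · rintro ⟨k, hk, e⟩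
      have hkv := hv k hk
      refine ⟨fun h => s_ne_one hkv (e.trans (congrArg Subtype.val h)), fun y hy => ?_⟩
      have hy' : bruhatLE n y.1 (pr n [k]) := by rw [pr_single, e]; exact hy
      obtain ⟨M, hM, eM⟩ := DD_of_le (rd_single hkv.1 hkv.2) hy'
      rcases List.sublist_cons_iff.1 hM with h | ⟨r, rfl, h⟩
      · left
        rw [List.sublist_nil] at h
        subst h
        exact Subtype.ext eM.symm
      · right
        rw [List.sublist_nil] at h
        subst h
        apply Subtype.ext
        rw [← eM, pr_single, e]
  have hcard : W.toFinset.card = (permLen n (pr n W) - 3) + 2 := by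
    rw [← right_card, ← Set.ncard_image_of_injective _ E.symm.injective,
      ← Set.ncard_image_of_injective _ Subtype.val_injective, ← Set.ncard_coe_finset,
      ← Set.ncard_image_of_injOn (f := simpleT n)]
    · congr 1
      ext v
      simp only [Set.mem_image, List.coe_toFinset, Set.mem_setOf_eq]
      constructor
      · rintro ⟨k, hk, rfl⟩
        refine ⟨⟨simpleT n k, (s_le_iff hW (hv k hk)).2 hk⟩, ⟨E _, ?_, E.symm_apply_apply _⟩, rfl⟩
        rw [← hat, hleft]
        exact ⟨k, hk, rfl⟩
      · rintro ⟨x, ⟨p, hp, rfl⟩, rfl⟩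
        rw [← E.apply_symm_apply p, ← hat, hleft] at hp
        exact hp
    · intro a ha b hb h
      simp only [List.coe_toFinset, Set.mem_setOf_eq] at ha
      exact s_inj (hv a ha) h
  have hlt : ∀ u v : Equiv.Perm (Fin 3), bruhatLE 3 u v → u ≠ v →
      permLen n (E.symm (u, ∅)).1 < permLen n (E.symm (v, ∅)).1 := by
    intro u v h hne
    apply lt_len
    · rw [← hE, E.apply_symm_apply, E.apply_symm_apply]
      exact ⟨h, by simp⟩
    · intro e
      have := E.symm.injective (Subtype.ext e)
      exact hne (congrArg Prod.fst this)
  have hlen3 : 3 ≤ permLen n (pr n W) := by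
    have a1 := hlt 1 t1 (b3_bot _) (by decide)
    have a2 := hlt t1 (t1 * t2) (by rw [b3]; decide) (by decide)
    have a3 := hlt (t1 * t2) (t1 * t2 * t1) (by rw [b3]; decide) (by decide)
    have a4 : permLen n (E.symm (t1 * t2 * t1, ∅)).1 ≤ permLen n (pr n W) := by
      by_cases h : (E.symm (t1 * t2 * t1, ∅)).1 = pr n W
      · rw [h]
      · exact (lt_len (E.symm (t1 * t2 * t1, ∅)).2 h).le
    omega
  rw [rd_len hW] at hcard hlen3
  have hnn : ¬ W.Nodup := by
    intro h
    rw [List.toFinset_card_of_nodup h] at hcard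
    omega
  obtain ⟨A, i, C, B, rfl⟩ := dup_split hnn
  apply FC_of_word hW
  · apply (Multiset.toFinset_card_eq_card_iff_nodup
      (m := ((A ++ i :: C ++ B : List ℕ) : Multiset ℕ))).1
    have e1 : ((A ++ i :: C ++ B : List ℕ) : Multiset ℕ).toFinset =
        (A ++ i :: C ++ i :: B).toFinset := by
      ext k
      simp only [Multiset.mem_toFinset, Multiset.mem_coe, List.mem_toFinset, List.mem_append,
        List.mem_cons]
      tauto
    rw [e1, hcard]
    simp only [List.length_append, List.length_cons, Multiset.coe_card] at hlen3 ⊢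
    omega
  · rintro ⟨hC1, hC2⟩
    have hiv := hv i (by simp)
    have hi1v := hv (i + 1) (by simp [hC1])
    have hi2v := hv (i - 1) (by simp [hC2])
    -- the key property
    have key : ∀ M N : List ℕ, Rd n M → Rd n N → (∀ k, k ∈ M ↔ k ∈ N) → pr n M ≠ pr n N →
        M.Sublist (A ++ i :: C ++ i :: B) → N.Sublist (A ++ i :: C ++ i :: B) →
        bruhatLE n (E.symm (t1, ∅)).1 (pr n M) ∧ bruhatLE n (E.symm (t2, ∅)).1 (pr n M) := by
      intro M N hM hN hMN hne hMs hNs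
      have hMW := le_of_sublist hM hW hMs
      have hNW := le_of_sublist hN hW hNs
      have same : ∀ p, At (RR _) (1, ∅) p → (RR _ p (E ⟨_, hMW⟩) ↔ RR _ p (E ⟨_, hNW⟩)) := by
        intro p hp
        rw [← E.apply_symm_apply p, ← hat, hleft] at hp
        obtain ⟨k, hk, e⟩ := hp
        have hkv := hv k hk
        rw [← E.apply_symm_apply p, hE, hE, ← e]
        simp only
        rw [s_le_iff hM hkv, s_le_iff hN hkv]
        exact hMN k
      have hne' : E ⟨_, hMW⟩ ≠ E ⟨_, hNW⟩ := fun h =>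
        hne (congrArg Subtype.val (E.injective h))
      have same2 : (E ⟨_, hMW⟩).2 = (E ⟨_, hNW⟩).2 := by
        ext k
        have := same (1, {k}) ((right_at _).2 (Or.inr (Or.inr ⟨k, rfl⟩)))
        simpa [RR, b3_bot] using this
      have s1 : bruhatLE 3 t1 (E ⟨_, hMW⟩).1 ↔ bruhatLE 3 t1 (E ⟨_, hNW⟩).1 := by
        have := same (t1, ∅) ((right_at _).2 (Or.inl rfl))
        simpa [RR] using this
      have s2 : bruhatLE 3 t2 (E ⟨_, hMW⟩).1 ↔ bruhatLE 3 t2 (E ⟨_, hNW⟩).1 := by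
        have := same (t2, ∅) ((right_at _).2 (Or.inr (Or.inl rfl)))
        simpa [RR] using this
      have := b3_same _ _ (fun h => hne' (Prod.ext h same2)) s1 s2
      constructor
      · refine (hE (E.symm (t1, ∅)) ⟨_, hMW⟩).1 ?_
        rw [E.apply_symm_apply]
        exact ⟨this.1, by simp⟩
      · refine (hE (E.symm (t2, ∅)) ⟨_, hMW⟩).1 ?_
        rw [E.apply_symm_apply]
        exact ⟨this.2, by simp⟩
    have sub1 : ∀ k ∈ C, [i, k].Sublist (A ++ i :: C ++ i :: B) := by
      intro k hk
      refine List.Sublist.trans ?_ (List.sublist_append_left _ _)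
      refine List.Sublist.trans ?_ (List.sublist_append_right _ _)
      exact (List.singleton_sublist.2 hk).cons_cons i
    have sub2 : ∀ k ∈ C, [k, i].Sublist (A ++ i :: C ++ i :: B) := by
      intro k hk
      exact List.Sublist.append (l₁ := [k]) (l₂ := A ++ i :: C) (r₁ := [i])
        (List.singleton_sublist.2 (by simp [hk])) (by simp)
    have rd2 : ∀ a b, (1 ≤ a ∧ a < n) → (1 ≤ b ∧ b < n) → a ≠ b → Rd n [a, b] := by
      intro a b ha hb hab
      apply rd_nodup
      · intro k hk
        simp at hk
        rcases hk with rfl | rfl <;> assumption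
      · simpa using hab
    have k1 := key [i, i + 1] [i + 1, i] (rd2 _ _ hiv hi1v (by omega)) (rd2 _ _ hi1v hiv (by omega))
      (by intro k; simp; tauto) (noncomm hiv.1 hi1v.2) (sub1 _ hC1) (sub2 _ hC1)
    have k2 := key [i, i - 1] [i - 1, i] (rd2 _ _ hiv hi2v (by omega)) (rd2 _ _ hi2v hiv (by omega))
      (by intro k; simp; tauto) (by
        have := noncomm (n := n) hi2v.1 (by omega)
        rw [show i - 1 + 1 = i by omega] at this
        exact this.symm) (sub1 _ hC2) (sub2 _ hC2)
    have isi : ∀ p, At (RR _) (1, ∅) p → bruhatLE n (E.symm p).1 (pr n [i, i + 1]) →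
        bruhatLE n (E.symm p).1 (pr n [i, i - 1]) → simpleT n i = (E.symm p).1 := by
      intro p hp h1 h2
      rw [← E.apply_symm_apply p, ← hat, hleft] at hp
      obtain ⟨k, hk, e⟩ := hp
      have hkv := hv k hk
      rw [← e, s_le_iff (rd2 _ _ hiv hi1v (by omega)) hkv] at h1
      rw [← e, s_le_iff (rd2 _ _ hiv hi2v (by omega)) hkv] at h2
      rw [← e]
      simp at h1 h2
      congr 1
      omega
    have e1 := isi (t1, ∅) ((right_at _).2 (Or.inl rfl)) k1.1 k2.1
    have e2 := isi (t2, ∅) ((right_at _).2 (Or.inr (Or.inl rfl))) k1.2 k2.2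
    have := E.symm.injective (Subtype.ext (e1.symm.trans e2))
    exact absurd (congrArg Prod.fst this) t12_ne

end Sub9


namespace Sub9

def T {n : ℕ} (w : Equiv.Perm (Fin n)) (a b c : Fin n) : Prop :=
  a.val < b.val ∧ b.val < c.val ∧ (w b).val < (w a).val ∧ (w c).val < (w b).val

def F {n : ℕ} (w : Equiv.Perm (Fin n)) (a b c d : Fin n) : Prop :=
  a.val < b.val ∧ b.val < c.val ∧ c.val < d.val ∧ (w c).val < (w d).val ∧
    (w d).val < (w a).val ∧ (w a).val < (w b).val

def Av {n : ℕ} (w : Equiv.Perm (Fin n)) : Prop := ∀ a b c d, ¬ F w a b c d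
def AM {n : ℕ} (w : Equiv.Perm (Fin n)) : Prop :=
  ∀ a b c a' b' c', T w a b c → T w a' b' c' → a = a' ∧ b = b' ∧ c = c'
def Ex {n : ℕ} (w : Equiv.Perm (Fin n)) : Prop := ∃ a b c, T w a b c

lemma occ321 {n : ℕ} (w : Equiv.Perm (Fin n)) (j : Fin 3 → Fin n) :
    IsPatternOcc w pattern321 j ↔ T w (j 0) (j 1) (j 2) := by
  have p0 : (pattern321 0).val = 2 := by decide
  have p1 : (pattern321 1).val = 1 := by decide
  have p2 : (pattern321 2).val = 0 := by decide
  constructor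
  · rintro ⟨h1, h2⟩
    refine ⟨h1 (by decide), h1 (by decide), (h2 1 0).2 (by decide), (h2 2 1).2 (by decide)⟩
  · rintro ⟨h1, h2, h3, h4⟩
    refine ⟨?_, ?_⟩
    · rw [Fin.strictMono_iff_lt_succ]
      intro i
      fin_cases i
      · exact h1
      · exact h2
    · intro a b
      have hc : ∀ x : Fin 3, x = 0 ∨ x = 1 ∨ x = 2 := by decide
      rw [Fin.lt_def, Fin.lt_def]
      rcases hc a with rfl | rfl | rfl <;> rcases hc b with rfl | rfl | rfl <;>
        simp only [p0, p1, p2] <;> omega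

lemma occ3412 {n : ℕ} (w : Equiv.Perm (Fin n)) (j : Fin 4 → Fin n) :
    IsPatternOcc w pattern3412 j ↔ F w (j 0) (j 1) (j 2) (j 3) := by
  have p0 : (pattern3412 0).val = 2 := by decide
  have p1 : (pattern3412 1).val = 3 := by decide
  have p2 : (pattern3412 2).val = 0 := by decide
  have p3 : (pattern3412 3).val = 1 := by decide
  constructor
  · rintro ⟨h1, h2⟩
    refine ⟨h1 (by decide), h1 (by decide), h1 (by decide), (h2 2 3).2 (by decide),
      (h2 3 0).2 (by decide), (h2 0 1).2 (by decide)⟩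
  · rintro ⟨h1, h2, h3, h4, h5, h6⟩
    refine ⟨?_, ?_⟩
    · rw [Fin.strictMono_iff_lt_succ]
      intro i
      fin_cases i
      · exact h1
      · exact h2
      · exact h3
    · intro a b
      have hc : ∀ x : Fin 4, x = 0 ∨ x = 1 ∨ x = 2 ∨ x = 3 := by decide
      rw [Fin.lt_def, Fin.lt_def]
      rcases hc a with rfl | rfl | rfl | rfl <;> rcases hc b with rfl | rfl | rfl | rfl <;>
        simp only [p0, p1, p2, p3] <;> omega

lemma cond_iff {n : ℕ} (w : Equiv.Perm (Fin n)) :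
    (ContainsPatternOnce w pattern321 ∧ AvoidsPattern w pattern3412) ↔ (Ex w ∧ AM w) ∧ Av w := by
  apply and_congr
  · constructor
    · rintro ⟨j, h1, h2⟩
      have h1' := (occ321 _ _).1 h1
      have u : ∀ a b c, T w a b c → a = j 0 ∧ b = j 1 ∧ c = j 2 := by
        intro a b c h
        have := h2 ![a, b, c] ((occ321 _ _).2 h)
        rw [← this]
        exact ⟨rfl, rfl, rfl⟩
      refine ⟨⟨_, _, _, h1'⟩, ?_⟩
      intro a b c a' b' c' h h'
      obtain ⟨rfl, rfl, rfl⟩ := u _ _ _ h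
      obtain ⟨rfl, rfl, rfl⟩ := u _ _ _ h'
      exact ⟨rfl, rfl, rfl⟩
    · rintro ⟨⟨a, b, c, h⟩, h2⟩
      refine ⟨![a, b, c], (occ321 _ _).2 h, ?_⟩
      intro j hj
      obtain ⟨e1, e2, e3⟩ := h2 _ _ _ _ _ _ ((occ321 _ _).1 hj) h
      ext i
      fin_cases i
      · exact congrArg Fin.val e1
      · exact congrArg Fin.val e2
      · exact congrArg Fin.val e3
  · constructor
    · intro h a b c d hF
      exact h ⟨![a, b, c, d], (occ3412 _ _).2 hF⟩
    · rintro h ⟨j, hj⟩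
      exact h _ _ _ _ ((occ3412 _ _).1 hj)

def Sim {n : ℕ} (w w' : Equiv.Perm (Fin n)) : Prop :=
  (Av w ↔ Av w') ∧ (AM w ↔ AM w') ∧ (Ex w ↔ Ex w')

lemma Sim.trans' {n : ℕ} {u v w : Equiv.Perm (Fin n)} (h : Sim u v) (h' : Sim v w) : Sim u w :=
  ⟨h.1.trans h'.1, h.2.1.trans h'.2.1, h.2.2.trans h'.2.2⟩

lemma block {n k : ℕ} {w : Equiv.Perm (Fin n)} (hk : 1 ≤ k ∧ k < n)
    (h : ∀ x, (w x).val < k ↔ x.val < k) : Sim (simpleT n k * w) w := by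
  have hT : ∀ a b c, T (simpleT n k * w) a b c ↔ T w a b c := by
    intro a b c
    have ha := h a
    have hb := h b
    have hc := h c
    have e : ∀ x y : Fin n, x.val < y.val → (w x).val ≠ (w y).val := by
      intro x y hxy he
      have := w.injective (Fin.ext he)
      subst this
      omega
    have e1 := e a b
    have e2 := e b c
    have e3 := e a c
    simp only [T, Equiv.Perm.mul_apply, sT_val hk.1 hk.2]
    generalize (w a).val = wa at *
    generalize (w b).val = wb at *
    generalize (w c).val = wc at *
    split_ifs <;> omega
  have hF : ∀ a b c d, F (simpleT n k * w) a b c d ↔ F w a b c d := by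
    intro a b c d
    have ha := h a
    have hb := h b
    have hc := h c
    have hd := h d
    have e : ∀ x y : Fin n, x.val < y.val → (w x).val ≠ (w y).val := by
      intro x y hxy he
      have := w.injective (Fin.ext he)
      subst this
      omega
    have e1 := e a b
    have e2 := e b c
    have e3 := e a c
    have e4 := e a d
    have e5 := e b d
    have e6 := e c d
    simp only [F, Equiv.Perm.mul_apply, sT_val hk.1 hk.2]
    generalize (w a).val = wa at *
    generalize (w b).val = wb at *
    generalize (w c).val = wc at *
    generalize (w d).val = wd at *
    by_cases hlt : a.val < b.val ∧ b.val < c.val ∧ c.val < d.val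
    · obtain ⟨l1, l2, l3⟩ := hlt
      have e1 := e1 l1
      have e2 := e2 l2
      have e3 := e3 (by omega)
      have e4 := e4 (by omega)
      have e5 := e5 (by omega)
      have e6 := e6 (by omega)
      simp only [l1, l2, l3, true_and]
      split_ifs <;> omega
    · constructor <;> intro h' <;> exact absurd ⟨h'.1, h'.2.1, h'.2.2.1⟩ hlt
  refine ⟨?_, ?_, ?_⟩
  · simp only [Av, hF]
  · simp only [AM, hT]
  · simp only [Ex, hT]

lemma T_inv {n : ℕ} {w : Equiv.Perm (Fin n)} {a b c : Fin n} (h : T w a b c) :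
    T w⁻¹ (w c) (w b) (w a) := by
  obtain ⟨h1, h2, h3, h4⟩ := h
  refine ⟨h4, h3, ?_, ?_⟩ <;> simpa using by assumption

lemma F_inv {n : ℕ} {w : Equiv.Perm (Fin n)} {a b c d : Fin n} (h : F w a b c d) :
    F w⁻¹ (w c) (w d) (w a) (w b) := by
  obtain ⟨h1, h2, h3, h4, h5, h6⟩ := h
  refine ⟨h4, h5, h6, ?_, ?_, ?_⟩ <;> simpa using by assumption

lemma sim_inv {n : ℕ} (w : Equiv.Perm (Fin n)) : Sim w⁻¹ w := by
  have h1 : ∀ w : Equiv.Perm (Fin n), Av w⁻¹ → Av w := fun w h a b c d hF => h _ _ _ _ (F_inv hF)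
  have h2 : ∀ w : Equiv.Perm (Fin n), AM w⁻¹ → AM w := by
    intro w h a b c a' b' c' hT hT'
    obtain ⟨e1, e2, e3⟩ := h _ _ _ _ _ _ (T_inv hT) (T_inv hT')
    exact ⟨w.injective e3, w.injective e2, w.injective e1⟩
  have h3 : ∀ w : Equiv.Perm (Fin n), Ex w → Ex w⁻¹ := by
    rintro w ⟨a, b, c, h⟩
    exact ⟨_, _, _, T_inv h⟩
  refine ⟨⟨h1 w, fun h => h1 _ (by rwa [inv_inv])⟩, ⟨h2 w, fun h => h2 _ (by rwa [inv_inv])⟩,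
    ⟨fun h => ?_, h3 w⟩⟩
  have := h3 _ h
  rwa [inv_inv] at this

lemma Sim.symm' {n : ℕ} {u v : Equiv.Perm (Fin n)} (h : Sim u v) : Sim v u :=
  ⟨h.1.symm, h.2.1.symm, h.2.2.symm⟩

lemma sT_inv' (n k : ℕ) : (simpleT n k)⁻¹ = simpleT n k :=
  inv_eq_of_mul_eq_one_left (sT_sq n k)

lemma block_right {n k : ℕ} {w : Equiv.Perm (Fin n)} (hk : 1 ≤ k ∧ k < n)
    (h : ∀ x, (w x).val < k ↔ x.val < k) : Sim (w * simpleT n k) w := by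
  have h1 := sim_inv (w * simpleT n k)
  rw [mul_inv_rev, sT_inv'] at h1
  have h2 : Sim (simpleT n k * w⁻¹) w⁻¹ := block hk (by
    intro x
    have := h (w⁻¹ x)
    simpa using this.symm)
  exact h1.symm'.trans' (h2.trans' (sim_inv w))

lemma pr_rev (n : ℕ) (L : List ℕ) : pr n L.reverse = (pr n L)⁻¹ := by
  induction L with
  | nil => simp [pr]
  | cons k L ih => rw [List.reverse_cons, pr_append, ih, pr_single, pr_cons, mul_inv_rev, sT_inv']

lemma peel {n : ℕ} {A M : List ℕ} (hA : A.Nodup) (hv : ∀ k ∈ A, (1 ≤ k ∧ k < n) ∧ k ∉ M) :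
    Sim (pr n (A ++ M)) (pr n M) := by
  induction A with
  | nil => exact ⟨Iff.rfl, Iff.rfl, Iff.rfl⟩
  | cons k A ih =>
    rw [List.nodup_cons] at hA
    refine Sim.trans' ?_ (ih hA.2 (fun x hx => hv x (by simp [hx])))
    rw [List.cons_append, pr_cons]
    apply block (hv k (by simp)).1
    intro x
    apply pr_lt
    rw [List.mem_append]
    rintro (h | h)
    · exact hA.1 h
    · exact (hv k (by simp)).2 h

lemma braid_val {n j : ℕ} (hj : j + 2 < n) (x : Fin n) : (pr n [j + 1, j + 2, j + 1] x).val =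
    if x.val = j then j + 2 else if x.val = j + 2 then j else x.val := by
  simp only [pr_cons, pr_nil, mul_one, Equiv.Perm.mul_apply,
    sT_val (show 1 ≤ j + 1 by omega) (show j + 1 < n by omega),
    sT_val (show 1 ≤ j + 2 by omega) hj]
  split_ifs <;> omega

lemma braid_base {n j : ℕ} (hj : j + 2 < n) :
    (Ex (pr n [j + 1, j + 2, j + 1]) ∧ AM (pr n [j + 1, j + 2, j + 1])) ∧
      Av (pr n [j + 1, j + 2, j + 1]) := by
  have hT : ∀ a b c, T (pr n [j + 1, j + 2, j + 1]) a b c →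
      a.val = j ∧ b.val = j + 1 ∧ c.val = j + 2 := by
    intro a b c h
    simp only [T, braid_val hj] at h
    split_ifs at h <;> omega
  refine ⟨⟨⟨⟨j, by omega⟩, ⟨j + 1, by omega⟩, ⟨j + 2, hj⟩, ?_⟩, ?_⟩, ?_⟩
  · simp only [T, braid_val hj]
    split_ifs <;> omega
  · intro a b c a' b' c' h h'
    have := hT _ _ _ h
    have := hT _ _ _ h'
    refine ⟨?_, ?_, ?_⟩ <;> apply Fin.ext <;> omega
  · intro a b c d h
    simp only [F, braid_val hj] at h
    split_ifs at h <;> omega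

lemma cond_of_form {n j : ℕ} {A B : List ℕ} (hj : j + 2 < n)
    (hv : ∀ k ∈ A ++ B, (1 ≤ k ∧ k < n) ∧ k ≠ j + 1 ∧ k ≠ j + 2) (hN : (A ++ B).Nodup) :
    (Ex (pr n (A ++ [j + 1, j + 2, j + 1] ++ B)) ∧ AM (pr n (A ++ [j + 1, j + 2, j + 1] ++ B))) ∧
      Av (pr n (A ++ [j + 1, j + 2, j + 1] ++ B)) := by
  rw [List.nodup_append] at hN
  have s1 : Sim (pr n (A ++ ([j + 1, j + 2, j + 1] ++ B))) (pr n ([j + 1, j + 2, j + 1] ++ B)) := by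
    apply peel hN.1
    intro k hk
    have := hv k (by simp [hk])
    refine ⟨this.1, ?_⟩
    intro h
    have hB : k ∉ B := fun hB => hN.2.2 k hk k hB rfl
    simp [hB] at h
    omega
  have s2 := (sim_inv (pr n ([j + 1, j + 2, j + 1] ++ B))).symm'
  rw [← pr_rev, List.reverse_append] at s2
  have s3 : Sim (pr n (B.reverse ++ [j + 1, j + 2, j + 1].reverse))
      (pr n [j + 1, j + 2, j + 1].reverse) := by
    apply peel (List.nodup_reverse.2 hN.2.1)
    intro k hk
    rw [List.mem_reverse] at hk
    have := hv k (by simp [hk])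
    refine ⟨this.1, ?_⟩
    intro h
    simp at h
    omega
  have s4 := s1.trans' (s2.trans' s3)
  have e : [j + 1, j + 2, j + 1].reverse = [j + 1, j + 2, j + 1] := by simp
  rw [e, ← List.append_assoc] at s4
  rw [s4.1, s4.2.1, s4.2.2]
  exact braid_base hj

lemma cond_of_FC {n : ℕ} {w : Equiv.Perm (Fin n)} (h : FC n w) : (Ex w ∧ AM w) ∧ Av w := by
  obtain ⟨A, B, j, hj, hv, hN, rfl⟩ := h
  exact cond_of_form hj hv hN

lemma not_Ex_nodup {n : ℕ} {L : List ℕ} (hN : L.Nodup) (hv : ∀ k ∈ L, 1 ≤ k ∧ k < n) :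
    ¬ Ex (pr n L) := by
  have := (peel (M := []) hN (fun k hk => ⟨hv k hk, by simp⟩)).2.2
  rw [List.append_nil] at this
  rw [this]
  rintro ⟨a, b, c, h1, h2, h3, h4⟩
  simp [pr] at h3
  omega

def W (n m : ℕ) (w : Equiv.Perm (Fin n)) : Prop :=
  ∃ L, pr n L = w ∧ (∀ k ∈ L, (1 ≤ k ∧ k < n) ∧ k < m) ∧
    (L.Nodup ∨ ∃ A B j, L = A ++ [j + 1, j + 2, j + 1] ++ B ∧
      (∀ k ∈ A ++ B, k ≠ j + 1 ∧ k ≠ j + 2) ∧ (A ++ B).Nodup)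

lemma W_inv {n m : ℕ} {w : Equiv.Perm (Fin n)} (h : W n m w⁻¹) : W n m w := by
  obtain ⟨L, h1, h2, h3⟩ := h
  refine ⟨L.reverse, by rw [pr_rev, h1, inv_inv], fun k hk => h2 k (List.mem_reverse.1 hk), ?_⟩
  rcases h3 with h3 | ⟨A, B, j, rfl, h4, h5⟩
  · exact Or.inl (List.nodup_reverse.2 h3)
  · right
    refine ⟨B.reverse, A.reverse, j, by simp, ?_, ?_⟩
    · intro k hk
      apply h4
      simp at hk ⊢
      tauto
    · rw [← List.reverse_append]
      exact List.nodup_reverse.2 h5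

lemma W_mono {n m m' : ℕ} {w : Equiv.Perm (Fin n)} (h : W n m w) (hm : m ≤ m') : W n m' w := by
  obtain ⟨L, h1, h2, h3⟩ := h
  exact ⟨L, h1, fun k hk => ⟨(h2 k hk).1, by have := (h2 k hk).2; omega⟩, h3⟩

lemma fix_lt {n m : ℕ} {w : Equiv.Perm (Fin n)} (h : ∀ x : Fin n, m ≤ x.val → w x = x) (x : Fin n) :
    (w x).val < m ↔ x.val < m := by
  constructor
  · intro h1
    by_contra h2
    rw [h x (by omega)] at h1
    exact h2 h1
  · intro h1
    by_contra h2
    have := w.injective (h (w x) (by omega))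
    rw [this] at h2
    exact h2 h1

lemma FC_of_W {n m : ℕ} {w : Equiv.Perm (Fin n)} (h : W n m w) (hE : Ex w) : FC n w := by
  obtain ⟨L, rfl, h2, h3⟩ := h
  rcases h3 with h3 | ⟨A, B, j, rfl, h4, h5⟩
  · exact absurd hE (not_Ex_nodup h3 (fun k hk => (h2 k hk).1))
  · refine ⟨A, B, j, (h2 (j + 2) (by simp)).1.2, ?_, h5, rfl⟩
    intro k hk
    refine ⟨(h2 k ?_).1, h4 k hk⟩
    simp at hk ⊢
    tauto

lemma step {n m : ℕ} {w : Equiv.Perm (Fin n)} (hm : m < n)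
    (IH : ∀ m' ≤ m, ∀ w : Equiv.Perm (Fin n), (∀ x : Fin n, m' ≤ x.val → w x = x) → Av w → AM w →
      W n m' w)
    (hf : ∀ x : Fin n, m + 1 ≤ x.val → w x = x) (hAv : Av w) (hAM : AM w)
    (a : Fin n) (ha : a.val < m) (hwa : w a = ⟨m, hm⟩)
    (hb : ∀ x : Fin n, a.val < x.val → x.val < m → (w ⟨m, hm⟩).val < (w x).val) :
    W n (m + 1) w := by
  have hinj : ∀ x y : Fin n, x.val ≠ y.val → (w x).val ≠ (w y).val := by
    intro x y hxy he
    exact hxy (congrArg Fin.val (w.injective (Fin.ext he)))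
  have hlt := fix_lt hf
  have hwa' : (w a).val = m := by rw [hwa]
  have hTx : ∀ x : Fin n, a.val < x.val → x.val < m → T w a x ⟨m, hm⟩ := by
    intro x h1 h2
    refine ⟨h1, h2, ?_, hb x h1 h2⟩
    have := hinj x a (by omega)
    have := (hlt x).2 (by omega)
    omega
  have ha2 : a.val + 1 = m ∨ a.val + 2 = m := by
    by_contra hcon
    have := (hAM _ _ _ _ _ _ (hTx ⟨a.val + 1, by omega⟩ (by simp) (by simp; omega))
      (hTx ⟨a.val + 2, by omega⟩ (by simp) (by simp; omega))).2.1
    simp at this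
  rcases ha2 with ha2 | ha2
  · obtain ⟨w', hw'⟩ : ∃ w', w' = w * simpleT n m := ⟨_, rfl⟩
    have hw : w = w' * simpleT n m := by rw [hw', mul_assoc, sT_sq, mul_one]
    have hf' : ∀ x : Fin n, m ≤ x.val → w' x = x := by
      intro x hx
      have hs := sT_val (show 1 ≤ m by omega) hm x
      rw [hw', Equiv.Perm.mul_apply]
      by_cases hxm : x.val = m
      · have : simpleT n m x = a := by
          apply Fin.ext
          rw [hs]
          split_ifs <;> omega
        rw [this, hwa]
        exact Fin.ext hxm.symm
      · have : simpleT n m x = x := by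
          apply Fin.ext
          rw [hs]
          split_ifs <;> omega
        rw [this]
        exact hf x (by omega)
    have hS : Sim w w' := by
      rw [hw]
      exact block_right ⟨by omega, hm⟩ (fix_lt hf')
    obtain ⟨L, h1, h2, h3⟩ := IH m le_rfl w' hf' (hS.1.1 hAv) (hS.2.1.1 hAM)
    have hmL : m ∉ L := fun h => by have := (h2 m h).2; omega
    refine ⟨L ++ [m], by rw [pr_append, pr_single, h1, hw], ?_, ?_⟩
    · intro k hk
      rw [List.mem_append, List.mem_singleton] at hk
      rcases hk with hk | rfl
      · have := h2 k hk
        omega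
      · omega
    · rcases h3 with h3 | ⟨A, B, j, rfl, h4, h5⟩
      · left
        rw [List.nodup_append]
        refine ⟨h3, by simp, ?_⟩
        intro x hx y hy
        rw [List.mem_singleton] at hy
        rintro rfl
        exact hmL (hy ▸ hx)
      · right
        refine ⟨A, B ++ [m], j, by simp, ?_, ?_⟩
        · intro k hk
          rw [← List.append_assoc, List.mem_append, List.mem_singleton] at hk
          rcases hk with hk | rfl
          · exact h4 k hk
          · constructor <;> rintro rfl <;> simp at hmL
        · rw [← List.append_assoc, List.nodup_append]
          refine ⟨h5, by simp, ?_⟩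
          intro x hx y hy
          rw [List.mem_singleton] at hy
          rintro rfl
          subst hy
          apply hmL
          simp at hx ⊢
          tauto
  · have hq : ∃ q : Fin n, q.val = m - 1 := ⟨⟨m - 1, by omega⟩, rfl⟩
    obtain ⟨q, hq⟩ := hq
    have hTq := hTx q (by omega) (by omega)
    have hbq := hb q (by omega) (by omega)
    have hqm := (hlt q).2 (by omega)
    have hqa := hinj q a (by omega)
    have hwq : w q = q := by
      by_contra hne
      have hne' : (w q).val ≠ q.val := fun h => hne (Fin.ext h)
      obtain ⟨z, hz⟩ := w.surjective q
      have hz' : (w z).val = m - 1 := by rw [hz, hq]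
      have z1 : z ≠ ⟨m, hm⟩ := by
        rintro rfl
        omega
      have z1' : z.val ≠ m := fun h => z1 (Fin.ext h)
      have z2 : z ≠ a := by
        rintro rfl
        omega
      have z2' : z.val ≠ a.val := fun h => z2 (Fin.ext h)
      have z3 : z ≠ q := by
        rintro rfl
        omega
      have z3' : z.val ≠ q.val := fun h => z3 (Fin.ext h)
      have z4 := (hlt z).1 (by omega)
      have : T w z q ⟨m, hm⟩ := ⟨by omega, hTq.2.1, by omega, hbq⟩
      exact z2 (hAM _ _ _ _ _ _ this hTq).1
    obtain ⟨j, rfl⟩ : ∃ j, m = j + 2 := ⟨a.val, ha2.symm⟩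
    obtain ⟨w', hw'⟩ : ∃ w', w' = w * pr n [j + 1, j + 2, j + 1] := ⟨_, rfl⟩
    have hsq : pr n [j + 1, j + 2, j + 1] * pr n [j + 1, j + 2, j + 1] = 1 := by
      have : pr n [j + 1, j + 2, j + 1] = (pr n [j + 1, j + 2, j + 1])⁻¹ := by
        rw [← pr_rev]; simp
      nth_rewrite 1 [this]
      simp
    have hw : w = w' * pr n [j + 1, j + 2, j + 1] := by rw [hw', mul_assoc, hsq, mul_one]
    have hv := braid_val hm
    have hf' : ∀ x : Fin n, j + 1 ≤ x.val → w' x = x := by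
      intro x hx
      have hs := hv x
      rw [hw', Equiv.Perm.mul_apply]
      by_cases hxm : x.val = j + 2
      · have : pr n [j + 1, j + 2, j + 1] x = a := by
          apply Fin.ext
          rw [hs]
          split_ifs <;> omega
        rw [this, hwa]
        exact Fin.ext hxm.symm
      · have : pr n [j + 1, j + 2, j + 1] x = x := by
          apply Fin.ext
          rw [hs]
          split_ifs <;> omega
        rw [this]
        by_cases hxq : x = q
        · rw [hxq, hwq]
        · have : x.val ≠ q.val := fun h => hxq (Fin.ext h)
          exact hf x (by omega)
    have hlt' := fix_lt hf'
    have hfv : ∀ x : Fin n, j + 1 ≤ x.val → (w' x).val = x.val := fun x hx => by rw [hf' x hx]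
    have hap : ∀ x, w' x = w (pr n [j + 1, j + 2, j + 1] x) := fun x => by
      rw [hw', Equiv.Perm.mul_apply]
    have hAv' : Av w' := by
      intro x y z t h
      have t1 := hfv t
      have t2 := hlt' x
      have t3 := hfv x
      have h' := h
      obtain ⟨h1, h2, h3, h4, h5, h6⟩ := h'
      have ht : t.val < j + 1 := by omega
      simp only [F, hap] at h
      refine hAv _ _ _ _ ⟨?_, ?_, ?_, h.2.2.2⟩ <;> rw [hv, hv] <;> split_ifs <;> omega
    have hEx' : ¬ Ex w' := by
      rintro ⟨x, y, z, h⟩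
      have t1 := hfv z
      have t2 := hlt' x
      have t3 := hfv x
      have h' := h
      obtain ⟨h1, h2, h3, h4⟩ := h'
      have ht : z.val < j + 1 := by omega
      simp only [T, hap] at h
      have hT' : T w (pr n [j + 1, j + 2, j + 1] x) (pr n [j + 1, j + 2, j + 1] y)
          (pr n [j + 1, j + 2, j + 1] z) := by
        refine ⟨?_, ?_, h.2.2⟩ <;> rw [hv, hv] <;> split_ifs <;> omega
      have := congrArg Fin.val (hAM _ _ _ _ _ _ hT' hTq).2.1
      rw [hv] at this
      split_ifs at this <;> omega
    obtain ⟨L, h1, h2, h3⟩ := IH (j + 1) (by omega) w' hf' hAv'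
      (fun a b c a' b' c' h _ => absurd ⟨a, b, c, h⟩ hEx')
    rcases h3 with h3 | h3
    · refine ⟨L ++ [j + 1, j + 2, j + 1] ++ [], ?_, ?_, Or.inr ⟨L, [], j, rfl, ?_, by simpa using h3⟩⟩
      · rw [List.append_nil, pr_append, h1, hw]
      · intro k hk
        simp only [List.append_nil, List.mem_append, List.mem_cons, List.not_mem_nil, or_false] at hk
        rcases hk with hk | hk
        · have := h2 k hk
          omega
        · omega
      · intro k hk
        rw [List.append_nil] at hk
        have := h2 k hk
        omega
    · exfalso
      obtain ⟨A, B, i, rfl, h4, h5⟩ := h3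
      apply hEx'
      have : FC n w' := by
        refine ⟨A, B, i, (h2 (i + 2) (by simp)).1.2, ?_, h5, h1.symm⟩
        intro k hk
        refine ⟨(h2 k ?_).1, h4 k hk⟩
        simp at hk ⊢
        tauto
      exact (cond_of_FC this).1.1

lemma W_all {n : ℕ} (m : ℕ) : ∀ w : Equiv.Perm (Fin n), (∀ x : Fin n, m ≤ x.val → w x = x) →
    Av w → AM w → W n m w := by
  induction m using Nat.strong_induction_on with
  | _ m IH =>
  intro w hf hAv hAM
  rcases m with _ | m
  · refine ⟨[], ?_, by simp, Or.inl (by simp)⟩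
    ext x
    rw [hf x (by omega)]
    rfl
  by_cases hm : m < n
  swap
  · exact W_mono (IH m (by omega) w (fun x hx => absurd x.2 (by omega)) hAv hAM) (by omega)
  by_cases hwm : w ⟨m, hm⟩ = ⟨m, hm⟩
  · refine W_mono (IH m (by omega) w (fun x hx => ?_) hAv hAM) (by omega)
    by_cases hx' : x.val = m
    · have : x = ⟨m, hm⟩ := Fin.ext hx'
      rw [this, hwm]
    · exact hf x (by omega)
  obtain ⟨a, hwa⟩ := w.surjective ⟨m, hm⟩
  have hlt := fix_lt hf
  have hwa' : (w a).val = m := by rw [hwa]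
  have hinj : ∀ x y : Fin n, x.val ≠ y.val → (w x).val ≠ (w y).val := by
    intro x y hxy he
    exact hxy (congrArg Fin.val (w.injective (Fin.ext he)))
  have ham : a.val ≠ m := by
    intro h
    have : a = ⟨m, hm⟩ := Fin.ext h
    rw [this] at hwa
    exact hwm hwa
  have ha : a.val < m := by
    have := (hlt a).1 (by omega)
    omega
  have hIH : ∀ m' ≤ m, ∀ w : Equiv.Perm (Fin n), (∀ x : Fin n, m' ≤ x.val → w x = x) → Av w →
      AM w → W n m' w := fun m' h => IH m' (by omega)
  by_cases hb : ∀ x : Fin n, a.val < x.val → x.val < m → (w ⟨m, hm⟩).val < (w x).val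
  · exact step hm hIH hf hAv hAM a ha hwa hb
  · push Not at hb
    obtain ⟨x, hx1, hx2, hx3⟩ := hb
    have hx4 := hinj ⟨m, hm⟩ x (by simp; omega)
    have hS := sim_inv w
    apply W_inv
    refine step hm hIH ?_ (hS.1.2 hAv) (hS.2.1.2 hAM) (w ⟨m, hm⟩) ?_ (by simp) ?_
    · intro y hy
      rw [Equiv.Perm.inv_eq_iff_eq]
      exact (hf y hy).symm
    · have h1 := (hlt ⟨m, hm⟩).2 (by simp)
      have h2 := hinj ⟨m, hm⟩ a (by simp; omega)
      omega
    · have e : w⁻¹ ⟨m, hm⟩ = a := by rw [Equiv.Perm.inv_eq_iff_eq, hwa]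
      rw [e]
      intro y hy1 hy2
      obtain ⟨z, rfl⟩ := w.surjective y
      rw [show w⁻¹ (w z) = z by simp]
      by_contra hcon
      have hza : z.val ≠ a.val := by
        intro h
        have : z = a := Fin.ext h
        subst this
        omega
      exact hAv z a x ⟨m, hm⟩ ⟨by omega, hx1, hx2, by omega, hy1, by omega⟩

theorem cond_FC {n : ℕ} (w : Equiv.Perm (Fin n)) :
    (ContainsPatternOnce w pattern321 ∧ AvoidsPattern w pattern3412) ↔ FC n w := by
  rw [cond_iff]
  constructor
  · rintro ⟨⟨h1, h2⟩, h3⟩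
    exact FC_of_W (W_all n w (fun x hx => absurd x.2 (by omega)) h3 h2) h1
  · exact cond_of_FC

end Sub9

/-- `w` contains 321 exactly once and avoids 3412 iff the Bruhat
interval `[e, w]` is isomorphic as a poset to `S₃ × B_{ℓ(w) - 3}`, where `S₃` carries its
Bruhat order and `B_k` is the Boolean lattice of rank `k`. -/
theorem stmt9 (n : ℕ) (w : Equiv.Perm (Fin n)) :
    (ContainsPatternOnce w pattern321 ∧ AvoidsPattern w pattern3412) ↔
      Nonempty
        ((fun x y : {v : Equiv.Perm (Fin n) // bruhatLE n v w} => bruhatLE n x.1 y.1) ≃r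
          (fun p q : Equiv.Perm (Fin 3) × Finset (Fin (permLen n w - 3)) =>
            bruhatLE 3 p.1 q.1 ∧ p.2 ⊆ q.2)) := by
  rw [Sub9.cond_FC]
  constructor
  · exact Sub9.iso_of_FC
  · rintro ⟨E⟩
    exact Sub9.FC_of_iso E
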